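/- arXiv:1805.08478 — 2 statements merged into one kernel-verified Lean document; each statement's English description precedes it below -/
import Mathlib

section
/- Let X be a CAT(0) cube complex that is complete (there is no infinite ascending chain of cubes) and has no free faces. Then X has no extremal vertices. -/
/-!
We use the standard combinatorial model of a CAT(0) cube complex: it is identified
with its vertex set endowed with the combinatorial (ℓ¹) metric, i.e. with a median
graph `G` on a vertex type `V`.  Halfspaces are realised as the vertex sets of the
two sides of the hyperplane dual to an edge, the Roller compactification `X̄` is the
set of ultrafilters of halfspaces, vertices embedding via principal ultrafilters,
and the Roller boundary `∂X` consists of the non-principal ultrafilters.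
-/

open scoped ENNReal
open Set

namespace CCCR

variable {V V' : Type*}

/-- The interval between two vertices w.r.t. the combinatorial metric. -/
def vInterval (G : SimpleGraph V) (u v : V) : Set V :=
  {w : V | G.dist u w + G.dist w v = G.dist u v}

/-- Combinatorial model of a CAT(0) cube complex (identified with its vertex set,
endowed with the combinatorial metric): a connected median graph. -/
def IsCCC (G : SimpleGraph V) : Prop :=
  G.Connected ∧ ∀ x y z : V, ∃! m : V,
    m ∈ vInterval G x y ∧ m ∈ vInterval G y z ∧ m ∈ vInterval G z x

/-- Halfspaces of the cube complex: the sides of the hyperplane dual to an edge. -/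
def IsHalfspace (G : SimpleGraph V) (h : Set V) : Prop :=
  ∃ u v : V, G.Adj u v ∧ h = {w : V | G.dist w v < G.dist w u}

/-- The halfspace dual to the (oriented) edge `(u,v)` containing `v`. -/
def edgeHalf (G : SimpleGraph V) (u v : V) : Set V :=
  {w : V | G.dist w v < G.dist w u}

/-- The hyperplane (wall) dual to the edge `(u,v)`, recorded as its pair of sides. -/
def wallOf (G : SimpleGraph V) (u v : V) : Set (Set V) :=
  {edgeHalf G u v, (edgeHalf G u v)ᶜ}

/-- Two (necessarily distinct) hyperplanes, with respective sides `h` and `k`,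
are transverse: all four quarter-spaces are nonempty. -/
def Transv (h k : Set V) : Prop :=
  (h ∩ k).Nonempty ∧ (h ∩ kᶜ).Nonempty ∧ (hᶜ ∩ k).Nonempty ∧ (hᶜ ∩ kᶜ).Nonempty

/-- An ultrafilter of halfspaces: a point of the Roller compactification X̄.
It contains exactly one side of each hyperplane, and any two members intersect. -/
def IsUltra (G : SimpleGraph V) (σ : Set (Set V)) : Prop :=
  (∀ h ∈ σ, IsHalfspace G h) ∧
  (∀ h : Set V, IsHalfspace G h → (h ∈ σ ↔ hᶜ ∉ σ)) ∧
  (∀ h ∈ σ, ∀ k ∈ σ, (h ∩ k).Nonempty)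

/-- The principal ultrafilter of a vertex, i.e. the image of `v` in X̄. -/
def princ (G : SimpleGraph V) (v : V) : Set (Set V) :=
  {h : Set V | IsHalfspace G h ∧ v ∈ h}

/-- A point of the Roller boundary ∂X = X̄ ∖ X: a non-principal ultrafilter. -/
def IsBdryPt (G : SimpleGraph V) (σ : Set (Set V)) : Prop :=
  IsUltra G σ ∧ ∀ v : V, σ ≠ princ G v

/-- The Roller boundary ∂X as a type. -/
abbrev Bdry (G : SimpleGraph V) : Type _ := {σ : Set (Set V) // IsBdryPt G σ}

/-- The Gromov product (x·y)_v = #𝒲(v | x, y) ∈ ℕ ∪ {+∞}, counted through the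
sides containing both x and y but not v. -/
noncomputable def grom (_G : SimpleGraph V) (v : V) (x y : Set (Set V)) : ℕ∞ :=
  {h : Set V | h ∈ x ∧ h ∈ y ∧ v ∉ h}.encard

/-- The embedding ℕ ∪ {+∞} → ℤ ∪ {±∞}. -/
noncomputable def toE (n : ℕ∞) : EReal := ((n : ℝ≥0∞) : EReal)

/-- The cross ratio cr_v(x,y,z,w) = (x·z)_v + (y·w)_v − (x·w)_v − (y·z)_v ∈ ℤ ∪ {±∞}. -/
noncomputable def crv (G : SimpleGraph V) (v : V) (x y z w : Set (Set V)) : EReal :=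
  toE (grom G v x z) + toE (grom G v y w) - toE (grom G v x w) - toE (grom G v y z)

/-- The triple of sums of Gromov products attached to a 4-tuple. -/
noncomputable def tripod (G : SimpleGraph V) (v : V) (x y z w : Set (Set V)) :
    ℕ∞ × ℕ∞ × ℕ∞ :=
  (grom G v x y + grom G v z w, grom G v x z + grom G v y w, grom G v x w + grom G v y z)

/-- (x,y,z,w) ∈ 𝒜 w.r.t. the basepoint v: at most one of the three sums is infinite. -/
def inA (G : SimpleGraph V) (v : V) (x y z w : Set (Set V)) : Prop :=
  ((tripod G v x y z w).1 ≠ ⊤ ∧ (tripod G v x y z w).2.1 ≠ ⊤) ∨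
  ((tripod G v x y z w).1 ≠ ⊤ ∧ (tripod G v x y z w).2.2 ≠ ⊤) ∨
  ((tripod G v x y z w).2.1 ≠ ⊤ ∧ (tripod G v x y z w).2.2 ≠ ⊤)

/-- (x,y,z,w) ∈ 𝒜 (this is independent of the basepoint). -/
def memA (G : SimpleGraph V) (x y z w : Set (Set V)) : Prop :=
  ∀ v : V, inA G v x y z w

/-- Two triples in (ℕ ∪ {+∞})³ are equivalent if they differ by adding a constant
n ∈ ℕ to all three entries. -/
def TripEquiv (p q : ℕ∞ × ℕ∞ × ℕ∞) : Prop :=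
  (∃ n : ℕ, p.1 = q.1 + (n : ℕ∞) ∧ p.2.1 = q.2.1 + (n : ℕ∞) ∧ p.2.2 = q.2.2 + (n : ℕ∞)) ∨
  (∃ n : ℕ, q.1 = p.1 + (n : ℕ∞) ∧ q.2.1 = p.2.1 + (n : ℕ∞) ∧ q.2.2 = p.2.2 + (n : ℕ∞))

/-- crt(x,y,z,w) = ⟪a:b:c⟫ (the cross ratio triple is independent of the basepoint,
so we require the equality of classes at every basepoint). -/
def crtEq (G : SimpleGraph V) (x y z w : Set (Set V)) (a b c : ℕ∞) : Prop :=
  ∀ v : V, TripEquiv (tripod G v x y z w) (a, b, c)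

/-- The median of three points of X̄. -/
def med (x y z : Set (Set V)) : Set (Set V) := (x ∩ y) ∪ (y ∩ z) ∪ (z ∩ x)

/-- The interval I(x,y) ⊆ X̄ between two points of X̄. -/
def rInterval (G : SimpleGraph V) (x y : Set (Set V)) : Set (Set (Set V)) :=
  {σ : Set (Set V) | IsUltra G σ ∧ x ∩ y ⊆ σ}

/-- `Op G x y z` : x and y are opposite with respect to z, i.e. the median
m = m(x,y,z) lies in X and I(x,y) = I(x,m) ∪ I(m,y). -/
def Op (G : SimpleGraph V) (x y z : Set (Set V)) : Prop :=
  (∃ p : V, med x y z = princ G p) ∧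
  rInterval G x y = rInterval G x (med x y z) ∪ rInterval G (med x y z) y

/-- A geodesic ray (based at `r 0`). -/
def IsGeodRay (G : SimpleGraph V) (r : ℕ → V) : Prop :=
  (∀ n : ℕ, G.Adj (r n) (r (n + 1))) ∧
  ∀ m n : ℕ, m ≤ n → G.dist (r m) (r n) = n - m

/-- A bi-infinite geodesic line. -/
def IsGeodLine (G : SimpleGraph V) (L : ℤ → V) : Prop :=
  (∀ n : ℤ, G.Adj (L n) (L (n + 1))) ∧
  ∀ m n : ℤ, m ≤ n → (G.dist (L m) (L n) : ℤ) = n - m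

/-- The set 𝒲(r) of hyperplanes crossed by (the edges of) a ray. -/
def rayWalls (G : SimpleGraph V) (r : ℕ → V) : Set (Set (Set V)) :=
  {W : Set (Set V) | ∃ n : ℕ, W = wallOf G (r n) (r (n + 1))}

/-- A hyperplane is adjacent to `v` if it is dual to an edge incident to `v`. -/
def WallAdjTo (G : SimpleGraph V) (v : V) (W : Set (Set V)) : Prop :=
  ∃ u : V, G.Adj v u ∧ W = wallOf G v u

/-- A straight ray: no two of the hyperplanes it crosses are transverse. -/
def RayStraight (G : SimpleGraph V) (r : ℕ → V) : Prop :=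
  ∀ m n : ℕ, ¬ Transv (edgeHalf G (r m) (r (m + 1))) (edgeHalf G (r n) (r (n + 1)))

/-- A straight line: no two of the hyperplanes it crosses are transverse. -/
def LineStraight (G : SimpleGraph V) (L : ℤ → V) : Prop :=
  ∀ m n : ℤ, ¬ Transv (edgeHalf G (L m) (L (m + 1))) (edgeHalf G (L n) (L (n + 1)))

/-- The endpoint at infinity r⁺ ∈ ∂X of a ray: the ultrafilter of those halfspaces
containing all but finitely many of its vertices. -/
def rayEnd (G : SimpleGraph V) (r : ℕ → V) : Set (Set V) :=
  {h : Set V | IsHalfspace G h ∧ ∃ N : ℕ, ∀ n : ℕ, N ≤ n → r n ∈ h}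

/-- A straight point of the Roller boundary: the endpoint at infinity of a straight ray. -/
def IsStraightPt (G : SimpleGraph V) (x : Set (Set V)) : Prop :=
  ∃ r : ℕ → V, IsGeodRay G r ∧ RayStraight G r ∧ rayEnd G r = x

/-- x and y are the two endpoints at infinity of the line L. -/
def LineEnds (G : SimpleGraph V) (L : ℤ → V) (x y : Set (Set V)) : Prop :=
  rayEnd G (fun n : ℕ => L (n : ℤ)) = x ∧ rayEnd G (fun n : ℕ => L (-(n : ℤ))) = y

/-- The edges from `v` to `a` and from `v` to `b` span a square. -/
def SpansSquare (G : SimpleGraph V) (v a b : V) : Prop :=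
  ∃ w : V, w ≠ v ∧ G.Adj a w ∧ G.Adj b w

/-- An extremal vertex: some edge at `v` spans a square with every other edge at `v`. -/
def Extremal (G : SimpleGraph V) (v : V) : Prop :=
  ∃ a : V, G.Adj v a ∧ ∀ b : V, G.Adj v b → b ≠ a → SpansSquare G v a b

/-- The cube complex has no extremal vertices. -/
def NoExtremal (G : SimpleGraph V) : Prop := ∀ v : V, ¬ Extremal G v

/-- A skinny vertex: exactly two incident edges. -/
def Skinny (G : SimpleGraph V) (v : V) : Prop := {u : V | G.Adj v u}.encard = 2

/-- A skinny ray: a geodesic ray whose initial vertex has at least three incident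
edges and all of whose other vertices are skinny. -/
def IsSkinnyRay (G : SimpleGraph V) (r : ℕ → V) : Prop :=
  IsGeodRay G r ∧ 3 ≤ {u : V | G.Adj (r 0) u}.encard ∧ ∀ n : ℕ, 1 ≤ n → Skinny G (r n)

/-- (The vertex set of) a cube of the complex: a subset inducing a hypercube graph. -/
def IsCube (G : SimpleGraph V) (c : Set V) : Prop :=
  ∃ (n : ℕ) (e : c ≃ (Fin n → Bool)),
    ∀ a b : c, G.Adj (a : V) (b : V) ↔ ∃! i : Fin n, e a i ≠ e b i

/-- A maximal cube. -/
def IsMaxCube (G : SimpleGraph V) (c : Set V) : Prop :=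
  IsCube G c ∧ ∀ c' : Set V, IsCube G c' → c ⊆ c' → c' = c

/-- Completeness: there is no infinite ascending chain of cubes. -/
def CubeComplete (G : SimpleGraph V) : Prop :=
  ¬ ∃ c : ℕ → Set V, (∀ n : ℕ, IsCube G (c n)) ∧ ∀ n : ℕ, c n ⊂ c (n + 1)

/-- No free faces: no non-maximal cube is contained in a unique maximal cube. -/
def NoFreeFaces (G : SimpleGraph V) : Prop :=
  ∀ c : Set V, IsCube G c → ¬ IsMaxCube G c → ¬ ∃! m : Set V, IsMaxCube G m ∧ c ⊆ m

/-- #𝒲(x, z | y, w): the number of hyperplanes separating x and z from y and w,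
counted through the sides containing x and z. -/
noncomputable def sepCount (x z y w : Set (Set V)) : ℕ∞ :=
  {h : Set V | h ∈ x ∧ h ∈ z ∧ h ∉ y ∧ h ∉ w}.encard

/-- A Möbius map between Roller boundaries: it maps 𝒜(X) into 𝒜(Y) and preserves
cross ratios. -/
def Mobius (G : SimpleGraph V) (G' : SimpleGraph V') (f : Bdry G → Bdry G') : Prop :=
  ∀ x y z w : Bdry G, memA G x.1 y.1 z.1 w.1 →
    memA G' (f x).1 (f y).1 (f z).1 (f w).1 ∧
    ∀ (v : V) (v' : V'),
      crv G' v' (f x).1 (f y).1 (f z).1 (f w).1 = crv G v x.1 y.1 z.1 w.1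

/-- The induced action of a cubical isomorphism on X̄: an ultrafilter is mapped to
the set of images of its halfspaces. -/
def mapUltra (φ : V → V') (σ : Set (Set V)) : Set (Set V') :=
  (fun h : Set V => φ '' h) '' σ

/-- The standard cubulation of ℝ: vertex set ℤ, edges between consecutive integers. -/
def zline : SimpleGraph ℤ := SimpleGraph.fromRel (fun m n => n = m + 1)

end CCCR

open CCCR

namespace CCCRaux

variable {V : Type*} {G : SimpleGraph V}

theorem adj_iff {x y : V} : G.Adj x y ↔ G.dist x y = 1 := SimpleGraph.dist_eq_one_iff_adj.symm

theorem bip (hG : IsCCC G) {x y : V} (h : G.Adj x y) (z : V) :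
    G.dist x z = G.dist y z + 1 ∨ G.dist y z = G.dist x z + 1 := by
  obtain ⟨m, ⟨h1, h2, h3⟩, -⟩ := hG.2 x y z
  simp only [vInterval, Set.mem_setOf_eq] at h1 h2 h3
  have hxy := adj_iff.1 h
  have e1 : G.dist x m = 0 ∨ G.dist m y = 0 := by omega
  have c1 := G.dist_comm (u := z) (v := x)
  have c2 := G.dist_comm (u := y) (v := x)
  have c3 := G.dist_comm (u := z) (v := y)
  rcases e1 with e | e
  · have := (hG.1.dist_eq_zero_iff).1 e
    subst this
    right; omega
  · have := (hG.1.dist_eq_zero_iff).1 e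
    subst this
    left; omega

theorem dist_two (hG : IsCCC G) {m y z : V} (hy : G.Adj y m) (hz : G.Adj z m) (hne : y ≠ z) :
    G.dist y z = 2 := by
  have h0 : G.dist y z ≠ 0 := fun h => hne ((hG.1.dist_eq_zero_iff).1 h)
  have h1 := bip hG hy z
  have h2 := adj_iff.1 hz.symm
  omega

theorem quad (hG : IsCCC G) {m y z u : V} (hy : G.Adj y m) (hz : G.Adj z m) (hne : y ≠ z)
    (h : G.dist y u = G.dist z u) :
    ∃ m', G.Adj y m' ∧ G.Adj z m' ∧ G.dist m' u + 1 = G.dist y u := by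
  have h2 := dist_two hG hy hz hne
  obtain ⟨m', ⟨h1, h3, h4⟩, -⟩ := hG.2 y z u
  simp only [vInterval, Set.mem_setOf_eq] at h1 h3 h4
  have c1 := G.dist_comm (u := u) (v := y)
  have c2 := G.dist_comm (u := m') (v := y)
  have c3 := G.dist_comm (u := m') (v := z)
  have c4 := G.dist_comm (u := m') (v := u)
  refine ⟨m', adj_iff.2 ?_, adj_iff.2 ?_, ?_⟩ <;> omega

theorem quad_unique (hG : IsCCC G) {m m' y z u : V} (hy : G.Adj y m) (hz : G.Adj z m)
    (hne : y ≠ z) (hy' : G.Adj y m') (hz' : G.Adj z m')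
    (h : G.dist y u = G.dist z u) (h1 : G.dist m u + 1 = G.dist y u)
    (h1' : G.dist m' u + 1 = G.dist y u) : m = m' := by
  have h2 := dist_two hG hy hz hne
  have c1 := G.dist_comm (u := u) (v := y)
  have key : ∀ n, G.Adj y n → G.Adj z n → G.dist n u + 1 = G.dist y u →
      n ∈ vInterval G y z ∧ n ∈ vInterval G z u ∧ n ∈ vInterval G u y := by
    intro n hyn hzn hn
    have a1 := adj_iff.1 hyn
    have a2 := adj_iff.1 hzn
    have c2 := G.dist_comm (u := n) (v := y)
    have c3 := G.dist_comm (u := n) (v := z)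
    have c4 := G.dist_comm (u := n) (v := u)
    simp only [vInterval, Set.mem_setOf_eq]
    omega
  exact (hG.2 y z u).unique (key m hy hz h1) (key m' hy' hz' h1')

theorem k23 (hG : IsCCC G) {p q x x' z : V} (hpq : p ≠ q) (h1 : G.Adj z p) (h2 : G.Adj z q)
    (h3 : G.Adj x p) (h4 : G.Adj x q) (h5 : G.Adj x' p) (h6 : G.Adj x' q)
    (hx : x ≠ z) (hx' : x' ≠ z) : x = x' := by
  by_contra hne
  have d1 := dist_two hG h3 h1 hx
  have d2 := dist_two hG h5 h1 hx'
  have d3 := adj_iff.1 h1.symm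
  have d4 := adj_iff.1 h2.symm
  exact hpq (quad_unique hG (u := z) h3 h5 hne h4 h6 (by omega) (by omega) (by omega))

/-- `x` is on the side of `a`. -/
def H (G : SimpleGraph V) (v a x : V) : Prop := G.dist x a + 1 = G.dist x v

theorem H_or (hG : IsCCC G) {v a : V} (h : G.Adj v a) (x : V) : H G v a x ∨ H G a v x := by
  have := bip hG h x
  rw [G.dist_comm (u := v), G.dist_comm (u := a)] at this
  unfold H; omega

theorem H_not {v a x : V} (h : H G v a x) (h' : H G a v x) : False := by
  unfold H at h h'; omega

theorem conv (hG : IsCCC G) {v a m y z : V} (h : G.Adj v a) (hym : G.Adj y m) (hzm : G.Adj z m)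
    (hne : y ≠ z) (hy : H G v a y) (hz : H G v a z) : H G v a m := by
  rcases H_or hG h m with h1 | h1
  · exact h1
  exfalso
  have b1 := bip hG hym v
  have b2 := bip hG hym a
  have b3 := bip hG hzm v
  have b4 := bip hG hzm a
  unfold H at *
  obtain ⟨m', e1, e2, e3⟩ := quad hG (u := a) hym hzm hne (by omega)
  have b5 := bip hG e1 v
  have b6 := H_or hG h m'
  unfold H at b6
  have := quad_unique hG (u := v) hym hzm hne e1 e2 (by omega) (by omega) (by omega)
  subst this
  omega

theorem par1 (hG : IsCCC G) {v a x y x' y' : V} (h : G.Adj v a) (hxy : G.Adj x y)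
    (hx : H G a v x) (hy : H G a v y) (hx' : H G v a x') (hy' : H G v a y')
    (ex : G.Adj x x') (ey : G.Adj y y') (hd : G.dist y a = G.dist x a + 1) : G.Adj x' y' := by
  have b1 := bip hG ey a
  have b2 := bip hG ey v
  have hne : x ≠ y' := by rintro rfl; exact H_not hx hy'
  have e : G.dist x a = G.dist y' a := by unfold H at *; omega
  obtain ⟨m, m1, m2, m3⟩ := quad hG (u := a) hxy ey.symm hne e
  have hm : H G v a m := by
    rcases H_or hG h m with h1 | h1
    · exact h1
    exfalso
    have hmy : m ≠ y := by rintro rfl; omega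
    exact H_not hy' (conv hG h.symm m2.symm ey hmy h1 hy)
  have : m = x' := by
    by_contra hne'
    exact H_not (conv hG h m1.symm ex.symm hne' hm hx') hx
  subst this
  exact m2.symm

theorem par (hG : IsCCC G) {v a x y x' y' : V} (h : G.Adj v a) (hxy : G.Adj x y)
    (hx : H G a v x) (hy : H G a v y) (hx' : H G v a x') (hy' : H G v a y')
    (ex : G.Adj x x') (ey : G.Adj y y') : G.Adj x' y' := by
  rcases bip hG hxy a with hd | hd
  · exact (par1 hG h hxy.symm hy hx hy' hx' ey ex hd).symm
  · exact par1 hG h hxy hx hy hx' hy' ex ey hd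

/-- `x` is on the side of `v` and adjacent to the other side. -/
def N (G : SimpleGraph V) (v a x : V) : Prop := H G a v x ∧ ∃ x', G.Adj x x' ∧ H G v a x'

theorem N_step (hG : IsCCC G) {v a z p q x : V} (h : G.Adj v a) (hz : N G v a z) (hp : N G v a p)
    (hq : N G v a q) (zp : G.Adj z p) (zq : G.Adj z q) (px : G.Adj p x) (qx : G.Adj q x)
    (hpq : p ≠ q) : N G v a x := by
  obtain ⟨hz, z', ez, hz'⟩ := hz
  obtain ⟨hp, p', ep, hp'⟩ := hp
  obtain ⟨hq, q', eq, hq'⟩ := hq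
  have hx : H G a v x := conv hG h.symm px qx hpq hp hq
  have zp' := par hG h zp hz hp hz' hp' ez ep
  have zq' := par hG h zq hz hq hz' hq' ez eq
  have hne : p' ≠ q' := by
    rintro rfl
    exact H_not hp' (conv hG h.symm ep eq hpq hp hq)
  have d1 : G.dist p' x = 2 := dist_two hG ep.symm px.symm (by rintro rfl; exact H_not hp' hx)
  have d2 : G.dist q' x = 2 := dist_two hG eq.symm qx.symm (by rintro rfl; exact H_not hq' hx)
  obtain ⟨m, m1, m2, m3⟩ := quad hG (u := x) zp'.symm zq'.symm hne (by omega)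
  refine ⟨hx, m, (adj_iff.2 (by omega)).symm, conv hG h m1 m2 hne hp' hq'⟩

theorem isCube_iff {c : Set V} : IsCube G c ↔ ∃ (n : ℕ) (f : (Fin n → Bool) → V),
    Function.Injective f ∧ Set.range f = c ∧ ∀ s t, G.Adj (f s) (f t) ↔ ∃! i, s i ≠ t i := by
  constructor
  · rintro ⟨n, e, he⟩
    refine ⟨n, fun s => (e.symm s : V), ?_, ?_, ?_⟩
    · exact Subtype.val_injective.comp e.symm.injective
    · ext x
      constructor
      · rintro ⟨s, rfl⟩; exact (e.symm s).2
      · intro hx; exact ⟨e ⟨x, hx⟩, by simp⟩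
    · intro s t
      rw [he]; simp
  · rintro ⟨n, f, hf, rfl, h⟩
    refine ⟨n, (Equiv.ofInjective f hf).symm, ?_⟩
    rintro ⟨_, s, rfl⟩ ⟨_, t, rfl⟩
    have k : ∀ s, (Equiv.ofInjective f hf).symm ⟨f s, s, rfl⟩ = s := fun s =>
      Equiv.ofInjective_symm_apply hf s
    rw [k, k]
    exact h s t

theorem adj_update {n : ℕ} {s : Fin n → Bool} {i : Fin n} {b : Bool} (h : s i ≠ b) :
    ∃! j, s j ≠ Function.update s i b j := by
  refine ⟨i, by simpa using h, ?_⟩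
  intro j hj
  by_contra hne
  simp [Function.update_of_ne hne] at hj

theorem eu_eq {m : ℕ} (i : Fin (m + 1)) {s t : Fin (m + 1) → Bool} (h : s i = t i) :
    (∃! j, s j ≠ t j) ↔ ∃! j, s (i.succAbove j) ≠ t (i.succAbove j) := by
  constructor
  · rintro ⟨j, hj, hu⟩
    have : j ≠ i := by rintro rfl; exact hj h
    obtain ⟨k, rfl⟩ := Fin.exists_succAbove_eq this
    exact ⟨k, hj, fun l hl => Fin.succAbove_right_injective (hu _ hl)⟩
  · rintro ⟨j, hj, hu⟩
    refine ⟨_, hj, fun l hl => ?_⟩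
    have : l ≠ i := by rintro rfl; exact hl h
    obtain ⟨k, rfl⟩ := Fin.exists_succAbove_eq this
    rw [hu k hl]

theorem eu_ne {m : ℕ} (i : Fin (m + 1)) {s t : Fin (m + 1) → Bool} (h : s i ≠ t i) :
    (∃! j, s j ≠ t j) ↔ ∀ j, s (i.succAbove j) = t (i.succAbove j) := by
  constructor
  · rintro ⟨j, hj, hu⟩ k
    by_contra hne
    have h1 := hu _ hne
    have h2 := hu _ h
    exact Fin.succAbove_ne i k (h1.trans h2.symm)
  · intro hk
    refine ⟨i, h, fun l hl => ?_⟩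
    by_contra hne
    obtain ⟨k, rfl⟩ := Fin.exists_succAbove_eq hne
    exact hl (hk k)

/-- Number of coordinates where two vertices of the hypercube differ. -/
def df {n : ℕ} (s t : Fin n → Bool) : ℕ := (Finset.univ.filter (fun i => s i ≠ t i)).card

theorem df_update {n : ℕ} {s t : Fin n → Bool} {i : Fin n} (h : s i ≠ t i) :
    df (Function.update s i (t i)) t < df s t := by
  apply Finset.card_lt_card
  rw [Finset.ssubset_iff_of_subset]
  · exact ⟨i, by simp [h]⟩
  · intro j hj
    by_cases hji : j = i
    · subst hji; simp at hj
    · simpa [Function.update_of_ne hji] using hj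

/-- All vertices of a cube at an extremal vertex carry the extremal direction. -/
theorem cube_N (hG : IsCCC G) {v a : V} (h : G.Adj v a)
    (hext : ∀ b : V, G.Adj v b → b ≠ a → SpansSquare G v a b) {n : ℕ} {f : (Fin n → Bool) → V}
    (hf : Function.Injective f) (hadj : ∀ s t, G.Adj (f s) (f t) ↔ ∃! i, s i ≠ t i)
    {s0 : Fin n → Bool} (h0 : f s0 = v) (ha : a ∉ Set.range f) :
    ∀ (k : ℕ) (s : Fin n → Bool), df s s0 = k → N G v a (f s) := by
  intro k
  induction k using Nat.strong_induction_on with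
  | _ k ih =>
  intro s hs
  by_cases hss : s = s0
  · subst hss
    rw [h0]
    have := adj_iff.1 h
    have h' := adj_iff.1 h.symm
    refine ⟨?_, a, h, ?_⟩ <;> unfold H <;> simp [this, h']
  obtain ⟨i, hi⟩ := Function.ne_iff.1 hss
  by_cases hj : ∃ j, j ≠ i ∧ s j ≠ s0 j
  · obtain ⟨j, hji, hj⟩ := hj
    have hji' : (Function.update s i (s0 i)) j ≠ s0 j := by
      rwa [Function.update_of_ne hji]
    have l1 := df_update hi
    have l2 := df_update hj
    have l3 := df_update hji'
    have N1 := ih (df (Function.update s i (s0 i)) s0) (by omega) _ rfl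
    have N2 := ih (df (Function.update s j (s0 j)) s0) (by omega) _ rfl
    have N3 := ih (df (Function.update (Function.update s i (s0 i)) j (s0 j)) s0)
      (by omega) _ rfl
    refine N_step hG h N3 N1 N2 ?_ ?_ ?_ ?_ ?_
    · exact ((hadj _ _).2 (adj_update hji')).symm
    · rw [Function.update_comm hji.symm]
      refine ((hadj _ _).2 (adj_update ?_)).symm
      rwa [Function.update_of_ne hji.symm]
    · exact ((hadj _ _).2 (adj_update hi)).symm
    · exact ((hadj _ _).2 (adj_update hj)).symm
    · intro he
      have := congrFun (hf he) i
      rw [Function.update_self, Function.update_of_ne hji.symm] at this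
      exact hi this.symm
  · push Not at hj
    have hvb : G.Adj v (f s) := by
      rw [← h0, hadj]
      refine ⟨i, fun h => hi h.symm, fun j hj' => ?_⟩
      by_contra hne
      exact hj' (hj j hne).symm
    have hba : f s ≠ a := fun he => ha ⟨s, he⟩
    obtain ⟨w, hwv, aw, bw⟩ := hext _ hvb hba
    have d1 := dist_two hG hvb.symm h.symm hba
    have d2 := dist_two hG aw.symm h hwv
    have d3 := adj_iff.1 hvb.symm
    have d4 := adj_iff.1 aw.symm
    refine ⟨?_, w, bw, ?_⟩ <;> unfold H
    · omega
    · have := bip hG aw v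
      have := adj_iff.1 h.symm
      have : G.dist w v ≠ 0 := fun h => hwv ((hG.1.dist_eq_zero_iff).1 h)
      omega

/-- Every maximal cube through an extremal vertex contains the extremal edge. -/
theorem max_mem (hG : IsCCC G) {v a : V} (h : G.Adj v a)
    (hext : ∀ b : V, G.Adj v b → b ≠ a → SpansSquare G v a b) {D : Set V}
    (hD : IsMaxCube G D) (hv : v ∈ D) : a ∈ D := by
  by_contra ha
  obtain ⟨n, f, hf, rfl, hadj⟩ := isCube_iff.1 hD.1
  obtain ⟨s0, h0⟩ := hv
  have hN : ∀ s, N G v a (f s) := fun s => cube_N hG h hext hf hadj h0 ha _ s rfl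
  have hW : ∀ s, H G a v (f s) := fun s => (hN s).1
  choose g hg hgW using fun s => (hN s).2
  have uniq1 : ∀ s t, G.Adj (f s) (g t) → s = t := by
    intro s t hst
    by_contra hne
    exact H_not (hgW t) (conv hG h.symm hst (hg t) (fun e => hne (hf e)) (hW s) (hW t))
  have ginj : Function.Injective g := by
    intro s t hst
    exact uniq1 s t (hst ▸ hg s)
  have hgadj : ∀ s t, G.Adj (g s) (g t) ↔ ∃! i, s i ≠ t i := by
    intro s t
    rw [← hadj]
    constructor
    · intro e
      exact par hG h.symm e (hgW s) (hgW t) (hW s) (hW t) (hg s).symm (hg t).symm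
    · intro e
      exact par hG h e (hW s) (hW t) (hgW s) (hgW t) (hg s) (hg t)
  have hfg : ∀ s t, f s ≠ g t := fun s t e => H_not (hgW t) (e ▸ hW s)
  let F : (Fin (n + 1) → Bool) → V := fun s =>
    if s 0 = true then g (fun j => s ((0 : Fin (n+1)).succAbove j))
    else f (fun j => s ((0 : Fin (n+1)).succAbove j))
  have ext0 : ∀ s t : Fin (n + 1) → Bool, s 0 = t 0 →
      (fun j => s ((0 : Fin (n+1)).succAbove j)) = (fun j => t ((0 : Fin (n+1)).succAbove j)) →
      s = t := by
    intro s t h1 h2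
    funext j
    by_cases hj : j = 0
    · rw [hj, h1]
    · obtain ⟨k, rfl⟩ := Fin.exists_succAbove_eq hj
      exact congrFun h2 k
  have hcube : IsCube G (Set.range F) := by
    refine isCube_iff.2 ⟨n + 1, F, ?_, rfl, ?_⟩
    · intro s t hst
      by_cases hs : s 0 = true <;> by_cases ht : t 0 = true <;> simp only [F, hs, ht, if_true,
        if_false] at hst
      · exact ext0 s t (hs.trans ht.symm) (ginj hst)
      · exact absurd hst.symm (hfg _ _)
      · exact absurd hst (hfg _ _)
      · exact ext0 s t (by simp at hs ht; rw [hs, ht]) (hf hst)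
    · intro s t
      by_cases hs : s 0 = true <;> by_cases ht : t 0 = true <;> simp only [F, hs, ht, if_true,
        if_false]
      · rw [eu_eq 0 (hs.trans ht.symm), hgadj]
      · rw [eu_ne 0 (by rw [hs]; exact fun e => ht e.symm)]
        constructor
        · intro e j
          exact (congrFun (uniq1 _ _ e.symm) j).symm
        · intro e
          rw [← funext e]
          exact (hg _).symm
      · rw [eu_ne 0 (by rw [ht]; exact hs)]
        constructor
        · intro e j
          exact congrFun (uniq1 _ _ e) j
        · intro e
          rw [← funext e]
          exact hg _
      · rw [eu_eq 0 (by simp at hs ht; rw [hs, ht])]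
        exact hadj _ _
  have hsub : Set.range f ⊆ Set.range F := by
    rintro _ ⟨s, rfl⟩
    refine ⟨Fin.cons false s, ?_⟩
    simp [F]
  have heq := hD.2 _ hcube hsub
  have : g s0 ∈ Set.range f := by
    rw [← heq]
    refine ⟨Fin.cons true s0, ?_⟩
    simp [F]
  obtain ⟨s, hs⟩ := this
  exact hfg _ _ hs

theorem cube_square {D : Set V} (hD : IsCube G D) {z p q : V} (hz : z ∈ D) (hp : p ∈ D)
    (hq : q ∈ D) (zp : G.Adj z p) (zq : G.Adj z q) (hpq : p ≠ q) :
    ∃ x ∈ D, x ≠ z ∧ G.Adj x p ∧ G.Adj x q := by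
  obtain ⟨n, f, hf, rfl, hadj⟩ := isCube_iff.1 hD
  obtain ⟨z, rfl⟩ := hz
  obtain ⟨p, rfl⟩ := hp
  obtain ⟨q, rfl⟩ := hq
  have key : ∀ p, G.Adj (f z) (f p) → ∃ i, p = Function.update z i (!(z i)) := by
    intro p hp
    obtain ⟨i, hi, hu⟩ := (hadj _ _).1 hp
    refine ⟨i, funext fun j => ?_⟩
    by_cases hj : j = i
    · subst hj
      simp only [Function.update_self]
      revert hi
      cases z j <;> cases p j <;> simp
    · rw [Function.update_of_ne hj]
      by_contra hne
      exact hj (hu j (fun e => hne e.symm))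
  obtain ⟨i, rfl⟩ := key p zp
  obtain ⟨j, rfl⟩ := key q zq
  have hij : i ≠ j := by rintro rfl; exact hpq rfl
  refine ⟨_, ⟨Function.update (Function.update z i (!(z i))) j (!(z j)), rfl⟩, ?_, ?_, ?_⟩
  · intro e
    have := congrFun (hf e) j
    simp at this
  · refine ((hadj _ _).2 (adj_update ?_)).symm
    rw [Function.update_of_ne hij.symm]; simp
  · rw [Function.update_comm hij]
    refine ((hadj _ _).2 (adj_update ?_)).symm
    rw [Function.update_of_ne hij]; simp

theorem exists_max (hcomp : CubeComplete G) (v : V) : ∃ C, IsMaxCube G C ∧ v ∈ C := by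
  by_contra hno
  push Not at hno
  have step : ∀ c : {c : Set V // IsCube G c ∧ v ∈ c},
      ∃ c' : {c : Set V // IsCube G c ∧ v ∈ c}, c.1 ⊂ c'.1 := by
    rintro ⟨c, hc, hv⟩
    have : ¬ IsMaxCube G c := fun h => hno c h hv
    simp only [IsMaxCube, hc, true_and] at this
    push Not at this
    obtain ⟨c', h1, h2, h3⟩ := this
    exact ⟨⟨c', h1, h2 hv⟩, Set.ssubset_iff_subset_ne.2 ⟨h2, fun e => h3 e.symm⟩⟩
  choose nx hnx using step
  have hbase : IsCube G {v} := isCube_iff.2 ⟨0, fun _ => v, fun s t _ => Subsingleton.elim _ _,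
    by simp, by
      intro s t
      simp only [SimpleGraph.irrefl, false_iff]
      rintro ⟨i, -⟩
      exact i.elim0⟩
  let c : ℕ → {c : Set V // IsCube G c ∧ v ∈ c} := fun n => nx^[n] ⟨{v}, hbase, rfl⟩
  refine hcomp ⟨fun n => (c n).1, fun n => (c n).2.1, fun n => ?_⟩
  simp only [c, Function.iterate_succ_apply']
  exact hnx _

end CCCRaux

open CCCRaux in
/-- Remark `no extremal vertices`: a complete CAT(0) cube complex
with no free faces has no extremal vertices. -/
theorem stmt2 {V : Type*} (G : SimpleGraph V) (hG : IsCCC G)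
    (hcomp : CubeComplete G) (hfree : NoFreeFaces G) :
    NoExtremal G := by
  rintro v ⟨a, h, hext⟩
  obtain ⟨C, hC, hvC⟩ := exists_max hcomp v
  have haC := max_mem hG h hext hC hvC
  obtain ⟨n, f, hf, rfl, hadj⟩ := isCube_iff.1 hC.1
  obtain ⟨s0, h0⟩ := hvC
  obtain ⟨s1, h1⟩ := haC
  have h01 : G.Adj (f s0) (f s1) := by rw [h0, h1]; exact h
  obtain ⟨i, hi, hiu⟩ := (hadj _ _).1 h01
  obtain _ | m := n
  · exact i.elim0
  let φ : (Fin m → Bool) → (Fin (m + 1) → Bool) := fun t => i.insertNth (s0 i) t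
  have hφi : ∀ t, φ t i = s0 i := fun t => by simp [φ]
  have hφs : ∀ t j, φ t (i.succAbove j) = t j := fun t j => by simp [φ]
  have hmem : ∀ s : Fin (m + 1) → Bool, s i = s0 i → f s ∈ Set.range (fun t => f (φ t)) := by
    intro s hs
    refine ⟨fun j => s (i.succAbove j), ?_⟩
    refine congrArg f ?_
    funext j
    by_cases hj : j = i
    · rw [hj, hφi, hs]
    · obtain ⟨k, rfl⟩ := Fin.exists_succAbove_eq hj
      rw [hφs]
  have hFC : Set.range (fun t => f (φ t)) ⊆ Set.range f := by
    rintro _ ⟨t, rfl⟩; exact ⟨_, rfl⟩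
  have hFcube : IsCube G (Set.range (fun t => f (φ t))) := by
    refine isCube_iff.2 ⟨m, _, ?_, rfl, ?_⟩
    · intro t t' e
      have := hf e
      funext j
      rw [← hφs t, this, hφs]
    · intro t t'
      rw [hadj, eu_eq i (by rw [hφi, hφi])]
      simp only [hφs]
  have hFnot : ¬ IsMaxCube G (Set.range (fun t => f (φ t))) := by
    intro hm
    have e := hm.2 _ hC.1 hFC
    have : f s1 ∈ Set.range (fun t => f (φ t)) := by rw [← e]; exact ⟨_, rfl⟩
    obtain ⟨t, ht⟩ := this
    have := congrFun (hf ht) i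
    rw [hφi] at this
    exact hi this
  refine hfree _ hFcube hFnot ⟨_, ⟨hC, hFC⟩, ?_⟩
  rintro D ⟨hD, hFD⟩
  have hvD : v ∈ D := hFD (h0 ▸ hmem s0 rfl)
  have haD := max_mem hG h hext hD hvD
  have main : ∀ (k : ℕ) (s : Fin (m + 1) → Bool), df s s1 = k → f s ∈ D := by
    intro k
    induction k using Nat.strong_induction_on with
    | _ k ih =>
    intro s hs
    by_cases hsi : s i = s0 i
    · exact hFD (hmem s hsi)
    by_cases hss : s = s1
    · rw [hss, h1]; exact haD
    obtain ⟨j, hj⟩ := Function.ne_iff.1 hss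
    have hji : j ≠ i := by
      rintro rfl
      revert hi hj hsi
      cases s j <;> cases s0 j <;> cases s1 j <;> simp
    have l1 := df_update hj
    have M1 : f (Function.update s j (s1 j)) ∈ D := ih (df (Function.update s j (s1 j)) s1) (by omega) _ rfl
    have M2 : f (Function.update s i (s0 i)) ∈ D := hFD (hmem _ (by simp))
    have M3 : f (Function.update (Function.update s j (s1 j)) i (s0 i)) ∈ D :=
      hFD (hmem _ (by simp))
    have A1 : G.Adj (f (Function.update (Function.update s j (s1 j)) i (s0 i)))
        (f (Function.update s j (s1 j))) := by
      refine ((hadj _ _).2 (adj_update ?_)).symm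
      rwa [Function.update_of_ne hji.symm]
    have A2 : G.Adj (f (Function.update (Function.update s j (s1 j)) i (s0 i)))
        (f (Function.update s i (s0 i))) := by
      rw [Function.update_comm hji]
      refine ((hadj _ _).2 (adj_update ?_)).symm
      rwa [Function.update_of_ne hji]
    have A3 : G.Adj (f s) (f (Function.update s j (s1 j))) := (hadj _ _).2 (adj_update hj)
    have A4 : G.Adj (f s) (f (Function.update s i (s0 i))) := (hadj _ _).2 (adj_update hsi)
    have hpq : f (Function.update s j (s1 j)) ≠ f (Function.update s i (s0 i)) := by
      intro e
      have := congrFun (hf e) i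
      rw [Function.update_self, Function.update_of_ne hji.symm] at this
      exact hsi this
    have hne : f s ≠ f (Function.update (Function.update s j (s1 j)) i (s0 i)) := by
      intro e
      have := congrFun (hf e) i
      rw [Function.update_self] at this
      exact hsi this
    obtain ⟨x, hx, hxz, e1, e2⟩ := cube_square hD.1 M3 M1 M2 A1 A2 hpq
    rw [k23 hG hpq A1 A2 A3 A4 e1 e2 hne hxz]
    exact hx
  refine (hC.2 D hD.1 ?_)
  rintro _ ⟨s, rfl⟩
  exact main _ s rfl
end

section
/- Let X and Y be CAT(0) cube complexes with no extremal vertices and let f : ∂X → ∂Y be a Möbius bijection. Then for all x, y, z ∈ ∂X, one has x op_z y if and only if f(x) op_{f(z)} f(y). -/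
/-!
We use the standard combinatorial model of a CAT(0) cube complex: it is identified
with its vertex set endowed with the combinatorial (ℓ¹) metric, i.e. with a median
graph `G` on a vertex type `V`.  Halfspaces are realised as the vertex sets of the
two sides of the hyperplane dual to an edge, the Roller compactification `X̄` is the
set of ultrafilters of halfspaces, vertices embedding via principal ultrafilters,
and the Roller boundary `∂X` consists of the non-principal ultrafilters.
-/

open scoped ENNReal
open Set

open CCCR
namespace CCCR

section base
variable {V : Type*} {G : SimpleGraph V}

theorem step_toward (hc : G.Connected) {a c : V} (hac : a ≠ c) :
    ∃ p, G.Adj a p ∧ G.dist a c = G.dist p c + 1 := by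
  obtain ⟨w, hw⟩ := hc.exists_walk_length_eq_dist a c
  cases w with
  | nil => exact absurd rfl hac
  | @cons _ p _ h q =>
    refine ⟨p, h, ?_⟩
    have h1 : G.dist p c ≤ q.length := SimpleGraph.dist_le q
    have h2 : G.dist a c ≤ G.dist a p + G.dist p c := hc.dist_triangle
    have h3 : G.dist a p = 1 := SimpleGraph.dist_eq_one_iff_adj.2 h
    simp at hw
    omega

theorem adj_of_dist_one {a b : V} (h : G.dist a b = 1) : G.Adj a b :=
  SimpleGraph.dist_eq_one_iff_adj.1 h

theorem dist_of_adj {a b : V} (h : G.Adj a b) : G.dist a b = 1 :=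
  SimpleGraph.dist_eq_one_iff_adj.2 h

/-- Adjacent vertices are at distances differing by exactly one from any vertex. -/
theorem dist_adj (hG : IsCCC G) {u v : V} (h : G.Adj u v) (w : V) :
    G.dist w u = G.dist w v + 1 ∨ G.dist w v = G.dist w u + 1 := by
  obtain ⟨hc, hm⟩ := hG
  obtain ⟨m, ⟨h1, h2, h3⟩, -⟩ := hm w u v
  simp only [vInterval, mem_ofPred_eq] at h1 h2 h3
  have huv := dist_of_adj h
  have e1 := G.dist_comm (u := m) (v := u)
  have e2 := G.dist_comm (u := m) (v := v)
  have e3 := G.dist_comm (u := m) (v := w)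
  have e4 := G.dist_comm (u := v) (v := w)
  omega

theorem mem_edgeHalf {u v w : V} : w ∈ edgeHalf G u v ↔ G.dist w v < G.dist w u := Iff.rfl

theorem edgeHalf_compl (hG : IsCCC G) {u v : V} (h : G.Adj u v) :
    (edgeHalf G u v)ᶜ = edgeHalf G v u := by
  ext w
  simp only [mem_compl_iff, mem_edgeHalf]
  rcases dist_adj hG h w with h | h <;> omega

/-- No complete bipartite `K_{2,3}`. -/
theorem no_K23 (hG : IsCCC G) {s t a b c : V} (hst : s ≠ t)
    (hsa : G.Adj s a) (hsb : G.Adj s b) (hsc : G.Adj s c)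
    (hta : G.Adj t a) (htb : G.Adj t b) (htc : G.Adj t c)
    (hab : a ≠ b) (hbc : b ≠ c) (hca : c ≠ a) : False := by
  have key : ∀ {p q r : V}, G.Adj r p → G.Adj r q → p ≠ q →
      G.dist p r + G.dist r q = G.dist p q := by
    intro p q r h1 h2 hpq
    have e1 := dist_of_adj h1
    have e2 := dist_of_adj h2
    have e3 := dist_adj hG h1 q
    have e4 := hG.1.dist_eq_zero_iff (u := p) (v := q)
    have e5 := G.dist_comm (u := r) (v := q)
    have e6 := G.dist_comm (u := p) (v := q)
    have e7 := G.dist_comm (u := p) (v := r)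
    have e8 : G.dist p q ≠ 0 := fun h => hpq (e4.1 h)
    omega
  have := hG.2 a b c
  apply hst
  exact this.unique ⟨key hsa hsb hab, key hsb hsc hbc, key hsc hsa hca⟩
    ⟨key hta htb hab, key htb htc hbc, key htc hta hca⟩

theorem edgeHalf_convex_aux (hG : IsCCC G) {u v : V} (huv : G.Adj u v) (n : ℕ) :
    ∀ a b : V, G.dist a b = n → a ∈ edgeHalf G u v → b ∈ edgeHalf G u v →
      ∀ c ∈ vInterval G a b, c ∈ edgeHalf G u v := by
  have hc := hG.1
  induction n using Nat.strong_induction_on with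
  | _ n ih =>
  intro a b hab ha hb c hcI
  by_contra hcn
  have ha' := ha
  have hb' := hb
  rw [mem_edgeHalf] at ha' hb'
  simp only [vInterval, mem_ofPred_eq] at hcI
  have hac : a ≠ c := by rintro rfl; exact hcn ha
  obtain ⟨p, hap, hpd⟩ := step_toward hc hac
  have dap := dist_of_adj hap
  have t1 : G.dist p b ≤ G.dist p c + G.dist c b := hc.dist_triangle
  have t2 : G.dist a b ≤ G.dist a p + G.dist p b := hc.dist_triangle
  have hpn : p ∉ edgeHalf G u v := by
    intro hp
    exact hcn (ih (G.dist p b) (by omega) p b rfl hp hb c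
      (by simp only [vInterval, mem_ofPred_eq]; omega))
  have hpb : p ≠ b := by rintro rfl; exact hpn hb
  obtain ⟨e, hbe, hed⟩ := step_toward hc hpb.symm
  have dbe := dist_of_adj hbe
  have c1 := G.dist_comm (u := b) (v := p)
  have c2 := G.dist_comm (u := e) (v := p)
  have c3 := G.dist_comm (u := b) (v := e)
  have t3 : G.dist a e ≤ G.dist a p + G.dist p e := hc.dist_triangle
  have t4 : G.dist a b ≤ G.dist a e + G.dist e b := hc.dist_triangle
  have hen : e ∉ edgeHalf G u v := by
    intro he
    exact hpn (ih (G.dist a e) (by omega) a e rfl ha he p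
      (by simp only [vInterval, mem_ofPred_eq]; omega))
  rw [mem_edgeHalf] at hpn hen
  -- the median of a, b, v
  obtain ⟨m, ⟨m1, m2, m3⟩, -⟩ := hG.2 a b v
  simp only [vInterval, mem_ofPred_eq] at m1 m2 m3
  have hau := dist_adj hG huv a
  have hbu := dist_adj hG huv b
  have hpu := dist_adj hG huv p
  have heu := dist_adj hG huv e
  have c4 := G.dist_comm (u := v) (v := a)
  have c5 := G.dist_comm (u := v) (v := m)
  have c6 := G.dist_comm (u := m) (v := a)
  have c7 := G.dist_comm (u := m) (v := b)
  by_cases hma : m = a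
  · subst hma
    have t5 : G.dist e v ≤ G.dist e m + G.dist m v := hc.dist_triangle
    have t6 : G.dist b u ≤ G.dist b e + G.dist e u := hc.dist_triangle
    have c8 := G.dist_comm (u := e) (v := m)
    omega
  · obtain ⟨d, had, hdd⟩ := step_toward hc (Ne.symm hma)
    have dad := dist_of_adj had
    have t5 : G.dist d b ≤ G.dist d m + G.dist m b := hc.dist_triangle
    have t6 : G.dist a b ≤ G.dist a d + G.dist d b := hc.dist_triangle
    have t7 : G.dist d v ≤ G.dist d m + G.dist m v := hc.dist_triangle
    have t8 : G.dist a u ≤ G.dist a d + G.dist d u := hc.dist_triangle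
    have hdu := dist_adj hG huv d
    have hdh : d ∈ edgeHalf G u v := by rw [mem_edgeHalf]; omega
    -- square with corners a, p, d, q
    obtain ⟨q, ⟨q1, q2, q3⟩, -⟩ := hG.2 p d b
    simp only [vInterval, mem_ofPred_eq] at q1 q2 q3
    have hpd2 := dist_adj hG hap d
    have hpdne : p ≠ d := by rintro rfl; rw [mem_edgeHalf] at hdh; omega
    have hpd0 : G.dist p d ≠ 0 := fun h => hpdne (hc.dist_eq_zero_iff.1 h)
    have t9 : G.dist p d ≤ G.dist p a + G.dist a d := hc.dist_triangle
    have c9 := G.dist_comm (u := p) (v := a)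
    have c10 := G.dist_comm (u := d) (v := a)
    have c11 := G.dist_comm (u := d) (v := p)
    have c12 := G.dist_comm (u := q) (v := b)
    have c13 := G.dist_comm (u := q) (v := d)
    have c14 := G.dist_comm (u := p) (v := b)
    have c15 := G.dist_comm (u := p) (v := q)
    have hpq : G.dist p q = 1 := by omega
    have hdq : G.dist d q = 1 := by omega
    have hqh : q ∈ edgeHalf G u v :=
      ih (G.dist d b) (by omega) d b rfl hdh hb q
        (by simp only [vInterval, mem_ofPred_eq]; omega)
    rw [mem_edgeHalf] at hqh hdh
    obtain ⟨s, ⟨s1, s2, s3⟩, -⟩ := hG.2 p d u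
    simp only [vInterval, mem_ofPred_eq] at s1 s2 s3
    have hqu := dist_adj hG huv q
    have t10 : G.dist p v ≤ G.dist p a + G.dist a v := hc.dist_triangle
    have t11 : G.dist p v ≤ G.dist p q + G.dist q v := hc.dist_triangle
    have t12 : G.dist a u ≤ G.dist a p + G.dist p u := hc.dist_triangle
    have t13 : G.dist q u ≤ G.dist q p + G.dist p u := hc.dist_triangle
    have c16 := G.dist_comm (u := s) (v := d)
    have c17 := G.dist_comm (u := s) (v := p)
    have c18 := G.dist_comm (u := s) (v := u)
    have c19 := G.dist_comm (u := p) (v := u)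
    have hps : G.dist p s = 1 := by omega
    have hds : G.dist d s = 1 := by omega
    refine no_K23 hG hpdne hap.symm (adj_of_dist_one hpq) (adj_of_dist_one hps) had.symm
      (adj_of_dist_one hdq) (adj_of_dist_one hds) ?_ ?_ ?_
    · rintro rfl; omega
    · rintro rfl; omega
    · rintro rfl; omega

theorem isHalf_edge {u v : V} (h : G.Adj u v) : IsHalfspace G (edgeHalf G u v) :=
  ⟨u, v, h, rfl⟩

theorem half_compl (hG : IsCCC G) {h : Set V} (hh : IsHalfspace G h) : IsHalfspace G hᶜ := by
  obtain ⟨u, v, huv, rfl⟩ := hh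
  exact ⟨v, u, huv.symm, edgeHalf_compl hG huv⟩

theorem half_convex (hG : IsCCC G) {h : Set V} (hh : IsHalfspace G h) {a b c : V}
    (ha : a ∈ h) (hb : b ∈ h) (hc : c ∈ vInterval G a b) : c ∈ h := by
  obtain ⟨u, v, huv, rfl⟩ := hh
  exact edgeHalf_convex_aux hG huv _ a b rfl ha hb c hc

theorem half_eq_edge (hG : IsCCC G) {h : Set V} (hh : IsHalfspace G h) {a b : V}
    (hab : G.Adj a b) (ha : a ∉ h) (hb : b ∈ h) : h = edgeHalf G a b := by
  have d := dist_of_adj hab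
  have d' := G.dist_comm (u := a) (v := b)
  ext p
  rw [mem_edgeHalf]
  have hp := dist_adj hG hab p
  constructor
  · intro hph
    by_contra hlt
    exact ha (half_convex hG hh hph hb (by simp only [vInterval, mem_ofPred_eq]; omega))
  · intro hlt
    by_contra hph
    exact (half_convex hG (half_compl hG hh) (a := p) (b := a) (c := b) hph ha
      (by simp only [vInterval, mem_ofPred_eq]; omega)) hb

/-- A crossing edge on a geodesic. -/
theorem exists_cross (hG : IsCCC G) (n : ℕ) : ∀ (S : Set V) (a b : V), G.dist a b = n →
    a ∈ S → b ∉ S → ∃ p q, G.Adj p q ∧ p ∈ S ∧ q ∉ S ∧ p ∈ vInterval G a b ∧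
      q ∈ vInterval G a b := by
  induction n with
  | zero =>
    intro S a b h ha hb
    rw [hG.1.dist_eq_zero_iff] at h
    subst h; exact absurd ha hb
  | succ n ih =>
    intro S a b h ha hb
    have hne : a ≠ b := by rintro rfl; exact hb ha
    obtain ⟨c, hac, hd⟩ := step_toward hG.1 hne
    have d1 := dist_of_adj hac
    by_cases hcS : c ∈ S
    · obtain ⟨p, q, hpq, hp, hq, h1, h2⟩ := ih S c b (by omega) hcS hb
      refine ⟨p, q, hpq, hp, hq, ?_, ?_⟩
      · simp only [vInterval, mem_ofPred_eq] at *
        have t1 : G.dist a p ≤ G.dist a c + G.dist c p := hG.1.dist_triangle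
        have t2 : G.dist a b ≤ G.dist a p + G.dist p b := hG.1.dist_triangle
        omega
      · simp only [vInterval, mem_ofPred_eq] at *
        have t1 : G.dist a q ≤ G.dist a c + G.dist c q := hG.1.dist_triangle
        have t2 : G.dist a b ≤ G.dist a q + G.dist q b := hG.1.dist_triangle
        omega
    · refine ⟨a, c, hac, ha, hcS, ?_, ?_⟩ <;> simp only [vInterval, mem_ofPred_eq]
      · simp
      · omega

theorem finite_sep (hG : IsCCC G) (n : ℕ) : ∀ a b : V, G.dist a b = n →
    {h : Set V | IsHalfspace G h ∧ a ∈ h ∧ b ∉ h}.Finite := by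
  induction n with
  | zero =>
    intro a b h
    rw [hG.1.dist_eq_zero_iff] at h
    subst h
    convert Set.finite_empty
    ext h; simp
  | succ n ih =>
    intro a b h
    have hne : a ≠ b := by rintro rfl; simp at h
    obtain ⟨c, hac, hd⟩ := step_toward hG.1 hne
    refine ((ih c b (by omega)).union (Set.finite_singleton (edgeHalf G c a))).subset ?_
    rintro h ⟨h1, h2, h3⟩
    by_cases hc : c ∈ h
    · exact Or.inl ⟨h1, hc, h3⟩
    · exact Or.inr (half_eq_edge hG h1 hac.symm hc h2)

theorem finite_sep' (hG : IsCCC G) (a b : V) :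
    {h : Set V | IsHalfspace G h ∧ a ∈ h ∧ b ∉ h}.Finite := finite_sep hG _ a b rfl

/-- Edges at a vertex not spanning a square have disjoint halfspaces. -/
theorem disj_of_not_square (hG : IsCCC G) {q a b p : V} (ha : G.Adj q a) (hb : G.Adj q b)
    (hab : b ≠ a) (hs : ¬ SpansSquare G q a b) (h1 : p ∈ edgeHalf G q a)
    (h2 : p ∈ edgeHalf G q b) : False := by
  apply hs
  rw [mem_edgeHalf] at h1 h2
  obtain ⟨m, ⟨m1, m2, m3⟩, -⟩ := hG.2 a b p
  simp only [vInterval, mem_ofPred_eq] at m1 m2 m3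
  have e1 := dist_adj hG ha p
  have e2 := dist_adj hG hb p
  have e3 := dist_adj hG ha b
  have da := dist_of_adj ha
  have db := dist_of_adj hb
  have h0 : G.dist a b ≠ 0 := fun h => hab (hG.1.dist_eq_zero_iff.1 h).symm
  have c1 := G.dist_comm (u := a) (v := b)
  have c2 := G.dist_comm (u := b) (v := q)
  have c3 := G.dist_comm (u := a) (v := m)
  have c4 := G.dist_comm (u := b) (v := m)
  have c5 := G.dist_comm (u := p) (v := m)
  have c6 := G.dist_comm (u := p) (v := a)
  have c7 := G.dist_comm (u := p) (v := b)
  refine ⟨m, ?_, adj_of_dist_one (by omega), adj_of_dist_one (by omega)⟩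
  rintro rfl
  omega

end base
end CCCR

namespace CCCR
section ultra
variable {V : Type*} {G : SimpleGraph V}

theorem u_not {σ : Set (Set V)} (hσ : IsUltra G σ) {h : Set V} (hh : IsHalfspace G h)
    (hn : h ∉ σ) : hᶜ ∈ σ := by
  by_contra hc
  exact hn ((hσ.2.1 h hh).2 hc)

theorem u_compl {σ : Set (Set V)} (hσ : IsUltra G σ) {h : Set V} (hh : h ∈ σ) : hᶜ ∉ σ :=
  (hσ.2.1 h (hσ.1 h hh)).1 hh

theorem u_up {σ : Set (Set V)} (hσ : IsUltra G σ) {h k : Set V} (hh : h ∈ σ)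
    (hk : IsHalfspace G k) (hs : h ⊆ k) : k ∈ σ := by
  by_contra hn
  obtain ⟨p, hp1, hp2⟩ := hσ.2.2 h hh _ (u_not hσ hk hn)
  exact hp2 (hs hp1)

theorem princ_ultra (hG : IsCCC G) (v : V) : IsUltra G (princ G v) := by
  refine ⟨fun h hh => hh.1, ?_, fun h hh k hk => ⟨v, hh.2, hk.2⟩⟩
  intro h hh
  constructor
  · rintro h1 h2
    exact h2.2 h1.2
  · intro h1
    refine ⟨hh, ?_⟩
    by_contra hv
    exact h1 ⟨half_compl hG hh, hv⟩

theorem mem_med {x y z : Set (Set V)} {h : Set V} :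
    h ∈ med x y z ↔ (h ∈ x ∧ h ∈ y) ∨ (h ∈ y ∧ h ∈ z) ∨ (h ∈ z ∧ h ∈ x) := by
  simp only [med, mem_union, mem_inter_iff, or_assoc]

theorem med_ultra {x y z : Set (Set V)} (hx : IsUltra G x) (hy : IsUltra G y)
    (hz : IsUltra G z) : IsUltra G (med x y z) := by
  refine ⟨?_, ?_, ?_⟩
  · intro h hh
    rw [mem_med] at hh
    rcases hh with hh | hh | hh
    · exact hx.1 h hh.1
    · exact hy.1 h hh.1
    · exact hz.1 h hh.1
  · intro h hh
    have h1 := hx.2.1 h hh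
    have h2 := hy.2.1 h hh
    have h3 := hz.2.1 h hh
    rw [mem_med, mem_med]
    tauto
  · intro h hh k hk
    rw [mem_med] at hh hk
    have h1 := hx.2.2 h
    have h2 := hy.2.2 h
    have h3 := hz.2.2 h
    rcases hh with hh | hh | hh <;> rcases hk with hk | hk | hk
    all_goals first
      | exact h1 (by tauto) k (by tauto)
      | exact h2 (by tauto) k (by tauto)
      | exact h3 (by tauto) k (by tauto)

/-- A neighbour of `v` in the direction of `σ`. -/
theorem exists_toward (hG : IsCCC G) {σ : Set (Set V)} (hσ : IsUltra G σ) {v : V} {h : Set V}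
    (hh : h ∈ σ) (hv : v ∉ h) : ∃ u, G.Adj v u ∧ edgeHalf G v u ∈ σ := by
  have hH := hσ.1 h hh
  obtain ⟨p0, hp0, -⟩ := hσ.2.2 h hh h hh
  -- closest point of h
  obtain ⟨p, hp, hmin⟩ : ∃ p ∈ h, ∀ q ∈ h, G.dist v p ≤ G.dist v q := by
    have hne : (((fun q => G.dist v q) '' h)).Nonempty := ⟨_, p0, hp0, rfl⟩
    obtain ⟨p, hp, hpe⟩ := Nat.sInf_mem hne
    refine ⟨p, hp, fun q hq => ?_⟩
    have : G.dist v p = sInf ((fun q => G.dist v q) '' h) := hpe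
    rw [this]
    exact Nat.sInf_le ⟨q, hq, rfl⟩
  have hne : v ≠ p := by rintro rfl; exact hv hp
  obtain ⟨u, hvu, hd⟩ := step_toward hG.1 hne
  refine ⟨u, hvu, ?_⟩
  by_contra hn
  have hg := isHalf_edge hvu
  have hgc := u_not hσ hg hn
  obtain ⟨p2, hp2, hp2'⟩ := hσ.2.2 h hh _ hgc
  obtain ⟨m, ⟨m1, m2, m3⟩, -⟩ := hG.2 v p p2
  have hmh : m ∈ h := half_convex hG hH hp hp2 m2
  have := hmin m hmh
  have hmp : m = p := by
    simp only [vInterval, mem_ofPred_eq] at m1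
    exact hG.1.dist_eq_zero_iff.1 (by omega)
  subst hmp
  have hvg : v ∈ (edgeHalf G v u)ᶜ := by
    simp [mem_edgeHalf]
  have hpg := half_convex hG (half_compl hG hg) hp2' hvg m3
  apply hpg
  rw [mem_edgeHalf]
  have c1 := G.dist_comm (u := m) (v := u)
  have c2 := G.dist_comm (u := m) (v := v)
  omega

theorem mem_edgeHalf_right {u v : V} (h : G.Adj u v) : v ∈ edgeHalf G u v := by
  have := dist_of_adj h
  have c1 := G.dist_comm (u := u) (v := v)
  simp [mem_edgeHalf]; omega

theorem not_mem_edgeHalf_left {u v : V} : u ∉ edgeHalf G u v := by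
  simp [mem_edgeHalf]

theorem princ_of_finite_aux (hG : IsCCC G) {σ : Set (Set V)} (hσ : IsUltra G σ) (n : ℕ) :
    ∀ v, {h | h ∈ σ ∧ v ∉ h}.Finite → {h | h ∈ σ ∧ v ∉ h}.ncard = n → ∃ p, σ = princ G p := by
  induction n using Nat.strong_induction_on with
  | _ n ih =>
  intro v hf hn
  by_cases he : ∃ h, h ∈ σ ∧ v ∉ h
  · obtain ⟨h, hh, hv⟩ := he
    obtain ⟨u, hvu, hu⟩ := exists_toward hG hσ hh hv
    have hsub : {h | h ∈ σ ∧ u ∉ h} ⊂ {h | h ∈ σ ∧ v ∉ h} := by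
      refine ⟨?_, ?_⟩
      · rintro k ⟨hk, hku⟩
        refine ⟨hk, fun hkv => ?_⟩
        have := half_eq_edge hG (hσ.1 k hk) hvu.symm hku hkv
        subst this
        rw [← edgeHalf_compl hG hvu] at hk
        exact u_compl hσ hu hk
      · intro hs
        exact (hs (a := edgeHalf G v u) ⟨hu, not_mem_edgeHalf_left⟩).2 (mem_edgeHalf_right hvu)
    exact ih _ (hn ▸ Set.ncard_lt_ncard hsub hf) u (hf.subset hsub.1) rfl
  · push Not at he
    refine ⟨v, ?_⟩
    ext h
    constructor
    · intro hh
      exact ⟨hσ.1 h hh, he h hh⟩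
    · rintro ⟨hh, hv⟩
      by_contra hn
      exact he _ (u_not hσ hh hn) hv

theorem princ_of_finite (hG : IsCCC G) {σ : Set (Set V)} (hσ : IsUltra G σ) {v : V}
    (hf : {h | h ∈ σ ∧ v ∉ h}.Finite) : ∃ p, σ = princ G p :=
  princ_of_finite_aux hG hσ _ v hf rfl

theorem bdry_infinite (hG : IsCCC G) {σ : Set (Set V)} (hσ : IsBdryPt G σ) (v : V) :
    {h | h ∈ σ ∧ v ∉ h}.Infinite := by
  intro hf
  obtain ⟨p, hp⟩ := princ_of_finite hG hσ.1 hf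
  exact hσ.2 p hp

theorem bdry_of_infinite (hG : IsCCC G) {σ : Set (Set V)} (hσ : IsUltra G σ) {v : V}
    (hi : {h | h ∈ σ ∧ v ∉ h}.Infinite) : IsBdryPt G σ := by
  refine ⟨hσ, ?_⟩
  rintro p rfl
  apply hi
  refine (finite_sep' hG p v).subset ?_
  rintro h ⟨h1, h2⟩
  exact ⟨h1.1, h1.2, h2⟩

/-- Finite Gromov product. -/
def FP (_G : SimpleGraph V) (x y : Set (Set V)) : Prop :=
  ∀ v : V, {h : Set V | h ∈ x ∧ h ∈ y ∧ v ∉ h}.Finite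

theorem FP_of (hG : IsCCC G) {x y : Set (Set V)} (hx : IsUltra G x) {v : V}
    (hf : {h : Set V | h ∈ x ∧ h ∈ y ∧ v ∉ h}.Finite) : FP G x y := by
  intro u
  refine (hf.union (finite_sep' hG v u)).subset ?_
  rintro h ⟨h1, h2, h3⟩
  by_cases hv : v ∈ h
  · exact Or.inr ⟨hx.1 h h1, hv, h3⟩
  · exact Or.inl ⟨h1, h2, hv⟩

theorem inf_of_not_FP (hG : IsCCC G) {x y : Set (Set V)} (hx : IsUltra G x) (h : ¬ FP G x y)
    (v : V) : {h : Set V | h ∈ x ∧ h ∈ y ∧ v ∉ h}.Infinite :=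
  fun hf => h (FP_of hG hx hf)

theorem FP.symm {x y : Set (Set V)} (h : FP G x y) : FP G y x := by
  intro v
  refine (h v).subset ?_
  rintro k ⟨h1, h2, h3⟩
  exact ⟨h2, h1, h3⟩

theorem FP.grom {x y : Set (Set V)} (h : FP G x y) (v : V) : grom G v x y ≠ ⊤ :=
  Set.encard_ne_top_iff.2 (h v)

theorem FP_of_grom (hG : IsCCC G) {x y : Set (Set V)} (hx : IsUltra G x) {v : V}
    (h : CCCR.grom G v x y ≠ ⊤) : FP G x y :=
  FP_of hG hx (Set.encard_ne_top_iff.1 h)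

theorem med_princ (hG : IsCCC G) {x y z : Set (Set V)} (hx : IsUltra G x) (hy : IsUltra G y)
    (hz : IsUltra G z) (hxy : FP G x y) (hyz : FP G y z) (hzx : FP G z x) :
    ∃ p, med x y z = princ G p := by
  obtain ⟨v⟩ := hG.1.nonempty
  refine princ_of_finite hG (med_ultra hx hy hz) (v := v) ?_
  refine ((hxy v).union ((hyz v).union (hzx v))).subset ?_
  rintro h ⟨h1, h2⟩
  rw [mem_med] at h1
  rcases h1 with h1 | h1 | h1
  · exact Or.inl ⟨h1.1, h1.2, h2⟩
  · exact Or.inr (Or.inl ⟨h1.1, h1.2, h2⟩)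
  · exact Or.inr (Or.inr ⟨h1.1, h1.2, h2⟩)

theorem FP_of_med_princ (hG : IsCCC G) {x y z : Set (Set V)} (hx : IsUltra G x) {p : V}
    (h : med x y z = princ G p) : FP G x y := by
  refine FP_of hG hx (v := p) ?_
  convert Set.finite_empty
  ext k
  simp only [mem_ofPred_eq, mem_empty_iff_false, iff_false]
  rintro ⟨h1, h2, h3⟩
  have : k ∈ princ G p := h ▸ mem_med.2 (Or.inl ⟨h1, h2⟩)
  exact h3 this.2

theorem med_rot (x y z : Set (Set V)) : med x y z = med y z x := by
  ext h; simp only [mem_med]; tauto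

theorem med_swap (x y z : Set (Set V)) : med x y z = med y x z := by
  ext h; simp only [mem_med]; tauto

/-- Every edge extends to a straight ray. -/
theorem exists_straight (hG : IsCCC G) (hne : NoExtremal G) {v u : V} (hvu : G.Adj v u) :
    ∃ z, IsBdryPt G z ∧ edgeHalf G v u ∈ z ∧
      ∀ k ∈ z, v ∉ k → k ⊆ edgeHalf G v u := by
  have step : ∀ e : {e : V × V // G.Adj e.1 e.2}, ∃ e' : {e : V × V // G.Adj e.1 e.2},
      e'.1.1 = e.1.2 ∧ edgeHalf G e'.1.1 e'.1.2 ⊆ edgeHalf G e.1.1 e.1.2 := by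
    rintro ⟨⟨a, b⟩, hab⟩
    have := hne b
    simp only [Extremal, not_exists, not_and, not_forall] at this
    obtain ⟨c, hbc, hca, hs⟩ := this a hab.symm
    refine ⟨⟨(b, c), hbc⟩, rfl, ?_⟩
    intro p hp
    by_contra hn
    have hn' : p ∈ edgeHalf G b a := by
      rw [← edgeHalf_compl hG hab]; exact hn
    exact disj_of_not_square hG hab.symm hbc hca hs hn' hp
  choose nx hnx1 hnx2 using step
  let e : ℕ → {e : V × V // G.Adj e.1 e.2} := fun n => nx^[n] ⟨(v, u), hvu⟩
  have he : ∀ n, e (n + 1) = nx (e n) := fun n => Function.iterate_succ_apply' nx n _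
  let r : ℕ → V := fun n => (e n).1.1
  have hr1 : ∀ n, (e n).1.2 = r (n + 1) := by
    intro n
    show _ = (e (n+1)).1.1
    rw [he, hnx1]
  let k : ℕ → Set V := fun n => edgeHalf G (r n) (r (n + 1))
  have hadj : ∀ n, G.Adj (r n) (r (n + 1)) := by
    intro n
    have := (e n).2
    rwa [hr1] at this
  have hk1 : ∀ n, k (n + 1) ⊆ k n := by
    intro n
    show edgeHalf G (r (n+1)) (r (n + 1 + 1)) ⊆ edgeHalf G (r n) (r (n+1))
    have := hnx2 (e n)
    rw [← he, hr1, hr1] at this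
    exact this
  have hanti : ∀ m n, m ≤ n → k n ⊆ k m := fun m n hmn => antitone_nat_of_succ_le hk1 hmn
  have hin : ∀ m n, m < n → r n ∈ k m := by
    intro m n hmn
    obtain ⟨j, rfl⟩ : ∃ j, n = j + 1 := ⟨n - 1, by omega⟩
    exact hanti m j (by omega) (mem_edgeHalf_right (hadj j))
  have hout : ∀ m n, n ≤ m → r n ∉ k m := by
    intro m n hmn hr
    exact not_mem_edgeHalf_left (hanti n m hmn hr)
  have kinj : Function.Injective k := by
    intro m n hmn
    by_contra hne
    rcases lt_or_gt_of_ne hne with h | h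
    · exact hout n n le_rfl (hmn ▸ hin m n h)
    · exact hout m m le_rfl (hmn ▸ hin n m h)
  have khalf : ∀ n, IsHalfspace G (k n) := fun n => isHalf_edge (hadj n)
  -- the only halfspaces entered are the k n
  have hcross : ∀ h, IsHalfspace G h → ∀ m n, m ≤ n → r m ∉ h → r n ∈ h → ∃ j, m ≤ j ∧ j < n ∧ h = k j := by
    intro h hh m n hmn
    induction n, hmn using Nat.le_induction with
    | base => intro h1 h2; exact absurd h2 h1
    | succ n hmn ih =>
      intro h1 h2
      by_cases h3 : r n ∈ h
      · obtain ⟨j, hj⟩ := ih h1 h3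
        exact ⟨j, hj.1, by omega, hj.2.2⟩
      · exact ⟨n, hmn, by omega, half_eq_edge hG hh (hadj n) h3 h2⟩
  have hev : ∀ h, IsHalfspace G h →
      (∃ N, ∀ n, N ≤ n → r n ∈ h) ∨ (∃ N, ∀ n, N ≤ n → r n ∉ h) := by
    intro h hh
    by_cases hx : ∃ m n, m ≤ n ∧ r m ∉ h ∧ r n ∈ h
    · obtain ⟨m, n, hmn, h1, h2⟩ := hx
      obtain ⟨j, -, -, rfl⟩ := hcross h hh m n hmn h1 h2
      exact Or.inl ⟨j + 1, fun n hn => hin j n (by omega)⟩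
    · push Not at hx
      by_cases hy : ∃ m, r m ∉ h
      · obtain ⟨m, hm⟩ := hy
        exact Or.inr ⟨m, fun n hn => hx m n hn hm⟩
      · push Not at hy
        exact Or.inl ⟨0, fun n _ => hy n⟩
  have hultra : IsUltra G (rayEnd G r) := by
    refine ⟨fun h hh => hh.1, ?_, ?_⟩
    · intro h hh
      constructor
      · rintro ⟨-, N, hN⟩ ⟨-, M, hM⟩
        exact hM (max N M) (le_max_right _ _) (hN (max N M) (le_max_left _ _))
      · intro hn
        refine ⟨hh, ?_⟩
        rcases hev h hh with h1 | h1
        · exact h1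
        · exact absurd ⟨half_compl hG hh, h1⟩ hn
    · rintro h ⟨-, N, hN⟩ l ⟨-, M, hM⟩
      exact ⟨r (max N M), hN _ (le_max_left _ _), hM _ (le_max_right _ _)⟩
  have hkz : ∀ n, k n ∈ rayEnd G r := fun n => ⟨khalf n, n + 1, fun j hj => hin n j (by omega)⟩
  have hr0 : r 0 = v := rfl
  have hr1' : r 1 = u := by
    have := hr1 0
    exact this.symm
  have hk0 : k 0 = edgeHalf G v u := by
    show edgeHalf G (r 0) (r 1) = _
    rw [hr1', hr0]
  refine ⟨rayEnd G r, ?_, hk0 ▸ hkz 0, ?_⟩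
  · refine bdry_of_infinite hG hultra (v := v) ?_
    refine (Set.infinite_range_of_injective kinj).mono ?_
    rintro _ ⟨n, rfl⟩
    exact ⟨hkz n, hr0 ▸ hout n 0 (by omega)⟩
  · rintro h ⟨hh, N, hN⟩ hv
    obtain ⟨j, -, -, rfl⟩ := hcross h hh 0 N (by omega) hv (hN N le_rfl)
    rw [← hk0]
    exact hanti 0 j (by omega)

end ultra
end CCCR

namespace CCCR
section opp
variable {V : Type*} {G : SimpleGraph V}

/-- No two halfspaces leading from `m` towards `a` and `b` respectively intersect. -/
def NT (a b : Set (Set V)) (m : V) : Prop :=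
  ∀ h ∈ a, ∀ g ∈ b, m ∉ h → m ∉ g → ¬ (h ∩ g).Nonempty

theorem med_mem {a b c : Set (Set V)} {m : V} (hm : med a b c = princ G m) {k : Set V}
    (hk : (k ∈ a ∧ k ∈ b) ∨ (k ∈ b ∧ k ∈ c) ∨ (k ∈ c ∧ k ∈ a)) : m ∈ k := by
  have : k ∈ princ G m := hm ▸ mem_med.2 hk
  exact this.2

theorem op_iff (hG : IsCCC G) {a b c : Set (Set V)} (ha : IsUltra G a) (hb : IsUltra G b) :
    Op G a b c ↔ ∃ m, med a b c = princ G m ∧ NT a b m := by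
  constructor
  · rintro ⟨⟨m, hm⟩, heq⟩
    refine ⟨m, hm, ?_⟩
    rintro h hh g hg hmh hmg ⟨p, hp1, hp2⟩
    have hhb : h ∉ b := fun h' => hmh (med_mem hm (Or.inl ⟨hh, h'⟩))
    have hga : g ∉ a := fun h' => hmg (med_mem hm (Or.inl ⟨h', hg⟩))
    have hgh := hb.1 g hg
    have hhh := ha.1 h hh
    have hσ : med a b (princ G p) ∈ rInterval G a b :=
      ⟨med_ultra ha hb (princ_ultra hG p), fun k hk => mem_med.2 (Or.inl hk)⟩
    have h1 : h ∈ med a b (princ G p) := mem_med.2 (Or.inr (Or.inr ⟨⟨hhh, hp1⟩, hh⟩))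
    have h2 : g ∈ med a b (princ G p) := mem_med.2 (Or.inr (Or.inl ⟨hg, ⟨hgh, hp2⟩⟩))
    have hu := hσ.1
    rw [heq, hm] at hσ
    rcases hσ with hσ | hσ
    · exact u_compl hu h2 (hσ.2 ⟨u_not ha hgh hga, half_compl hG hgh, hmg⟩)
    · exact u_compl hu h1 (hσ.2 ⟨⟨half_compl hG hhh, hmh⟩, u_not hb hhh hhb⟩)
  · rintro ⟨m, hm, hNT⟩
    refine ⟨⟨m, hm⟩, ?_⟩
    rw [hm]
    ext σ
    constructor
    · rintro ⟨hu, hs⟩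
      by_contra hn
      simp only [mem_union, not_or, rInterval, mem_ofPred_eq, hu, true_and, not_subset] at hn
      obtain ⟨⟨k, ⟨hka, hkm⟩, hkσ⟩, ⟨l, ⟨hlm, hlb⟩, hlσ⟩⟩ := hn
      have hkb : k ∉ b := fun h => hkσ (hs ⟨hka, h⟩)
      have hla : l ∉ a := fun h => hlσ (hs ⟨h, hlb⟩)
      have hk := hkm.1
      have hl := hlm.1
      refine hNT _ (u_not ha hl hla) _ (u_not hb hk hkb) (fun h => h hlm.2) (fun h => h hkm.2) ?_
      exact hu.2.2 _ (u_not hu hl hlσ) _ (u_not hu hk hkσ)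
    · rintro (⟨hu, hs⟩ | ⟨hu, hs⟩)
      · refine ⟨hu, fun k hk => hs ⟨hk.1, ?_⟩⟩
        rw [← hm]; exact mem_med.2 (Or.inl hk)
      · refine ⟨hu, fun k hk => hs ⟨?_, hk.2⟩⟩
        rw [← hm]; exact mem_med.2 (Or.inl hk)

theorem exists_witness (hG : IsCCC G) (hne : NoExtremal G) {a b c : Set (Set V)}
    (ha : IsUltra G a) (hb : IsUltra G b) (hc : IsUltra G c) {m : V}
    (hm : med a b c = princ G m) (hNT : ¬ NT a b m) :
    ∃ w, IsBdryPt G w ∧ (∀ k ∈ c, k ∈ w → m ∈ k) ∧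
      (∃ h ∈ a, h ∈ w ∧ m ∉ h) ∧ (∃ h ∈ b, h ∈ w ∧ m ∉ h) := by
  simp only [NT, not_forall, not_not] at hNT
  obtain ⟨h, hha, g, hgb, hmh, hmg, p0, hp0h, hp0g⟩ := hNT
  have Hh := ha.1 h hha
  have Hg := hb.1 g hgb
  have hga : g ∉ a := fun h' => hmg (med_mem hm (Or.inl ⟨h', hgb⟩))
  have hgc : g ∉ c := fun h' => hmg (med_mem hm (Or.inr (Or.inl ⟨hgb, h'⟩)))
  have hhc : h ∉ c := fun h' => hmh (med_mem hm (Or.inr (Or.inr ⟨h', hha⟩)))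
  have hmout : ∀ k, IsHalfspace G k → k ∉ a → k ∉ b → m ∉ k := by
    intro k hk h1 h2 h3
    have : k ∈ med a b c := hm ▸ (⟨hk, h3⟩ : k ∈ princ G m)
    rw [mem_med] at this
    tauto
  obtain ⟨p1, hp1⟩ := princ_of_finite hG (med_ultra ha hb (princ_ultra hG p0)) (v := m) (by
    refine (finite_sep' hG p0 m).subset ?_
    rintro k ⟨hk, hmk⟩
    rw [mem_med] at hk
    rcases hk with hk | hk | hk
    · exact absurd (med_mem hm (Or.inl hk)) hmk
    · exact ⟨hk.2.1, hk.2.2, hmk⟩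
    · exact ⟨hk.1.1, hk.1.2, hmk⟩)
  have hp1h : p1 ∈ h := med_mem hp1 (Or.inr (Or.inr ⟨⟨Hh, hp0h⟩, hha⟩))
  have hp1g : p1 ∈ g := med_mem hp1 (Or.inr (Or.inl ⟨hgb, ⟨Hg, hp0g⟩⟩))
  have hp1out : ∀ k, IsHalfspace G k → k ∉ a → k ∉ b → p1 ∉ k := by
    intro k hk h1 h2 h3
    have : k ∈ med a b (princ G p0) := hp1 ▸ (⟨hk, h3⟩ : k ∈ princ G p1)
    rw [mem_med] at this
    tauto
  obtain ⟨q1, hq1⟩ := princ_of_finite hG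
    (med_ultra (princ_ultra hG m) ha (princ_ultra hG p1)) (v := m) (by
    refine (finite_sep' hG p1 m).subset ?_
    rintro k ⟨hk, hmk⟩
    rw [mem_med] at hk
    rcases hk with hk | hk | hk
    · exact absurd hk.1.2 hmk
    · exact ⟨hk.2.1, hk.2.2, hmk⟩
    · exact absurd hk.2.2 hmk)
  have hq1h : q1 ∈ h := med_mem hq1 (Or.inr (Or.inl ⟨hha, ⟨Hh, hp1h⟩⟩))
  have hq1g : q1 ∉ g := by
    intro h3
    have : g ∈ med (princ G m) a (princ G p1) := hq1 ▸ (⟨Hg, h3⟩ : g ∈ princ G q1)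
    rw [mem_med] at this
    rcases this with h | h | h
    · exact hga h.2
    · exact hga h.1
    · exact hmg h.2.2
  have hq1out : ∀ k, IsHalfspace G k → k ∉ a → k ∉ b → q1 ∉ k := by
    intro k hk h1 h2 h3
    have : k ∈ med (princ G m) a (princ G p1) := hq1 ▸ (⟨hk, h3⟩ : k ∈ princ G q1)
    have h4 := hmout k hk h1 h2
    rw [mem_med] at this
    rcases this with h | h | h
    · exact h1 h.2
    · exact h1 h.1
    · exact h4 h.2.2
  obtain ⟨q, p, hqp, hqg, hpg, hqI, hpI⟩ := exists_cross hG _ gᶜ q1 p1 rfl hq1g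
    (fun h => h hp1g)
  have hpg' : p ∈ g := by simpa using hpg
  have hqh : q ∈ h := half_convex hG Hh hq1h hp1h hqI
  have hge : g = edgeHalf G q p := half_eq_edge hG Hg hqp hqg hpg'
  obtain ⟨w, hw, hgw, hws⟩ := exists_straight hG hne hqp
  rw [← hge] at hgw hws
  refine ⟨w, hw, ?_, ⟨h, hha, ?_, hmh⟩, ⟨g, hgb, hgw, hmg⟩⟩
  · intro k hkc hkw
    by_contra hmk
    have hk := hc.1 k hkc
    have hka : k ∉ a := fun h' => hmk (med_mem hm (Or.inr (Or.inr ⟨hkc, h'⟩)))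
    have hkb : k ∉ b := fun h' => hmk (med_mem hm (Or.inr (Or.inl ⟨h', hkc⟩)))
    have hqk : q ∈ kᶜ := half_convex hG (half_compl hG hk) (hq1out k hk hka hkb)
      (hp1out k hk hka hkb) hqI
    exact hgc (u_up hc hkc Hg (hws k hkw hqk))
  · by_contra hhw
    exact hgc (u_up hc (u_not hc Hh hhc) Hg (hws _ (u_not hw.1 Hh hhw) (fun h => h hqh)))

end opp

section mob
variable {V V' : Type*} {G : SimpleGraph V} {G' : SimpleGraph V'}

theorem toE_zero : toE 0 = 0 := by simp [toE]

theorem toE_nonneg (n : ℕ∞) : 0 ≤ toE n := by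
  unfold toE; exact EReal.coe_ennreal_nonneg _

theorem toE_pos {n : ℕ∞} (h : n ≠ 0) : 0 < toE n := by
  unfold toE
  rw [EReal.coe_ennreal_pos]
  exact_mod_cast pos_iff_ne_zero.2 h

theorem toE_top : toE ⊤ = ⊤ := by simp [toE]

theorem toE_ne_bot (n : ℕ∞) : toE n ≠ ⊥ := by
  unfold toE; exact EReal.coe_ennreal_ne_bot _

theorem toE_ne_top {n : ℕ∞} (h : n ≠ ⊤) : toE n ≠ ⊤ := by
  unfold toE
  rw [Ne, EReal.coe_ennreal_eq_top_iff]
  simpa using h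

theorem toE_le {m n : ℕ∞} : toE m ≤ toE n ↔ m ≤ n := by
  unfold toE
  rw [EReal.coe_ennreal_le_coe_ennreal_iff]
  simp

theorem grom_zero {x y : Set (Set V)} {v : V} (h : ∀ k ∈ x, k ∈ y → v ∈ k) :
    grom G v x y = 0 := by
  unfold grom
  rw [Set.encard_eq_zero]
  ext k
  simp only [mem_ofPred_eq, mem_empty_iff_false, iff_false]
  rintro ⟨h1, h2, h3⟩
  exact h3 (h k h1 h2)

theorem grom_ne_zero {x y : Set (Set V)} {v : V} (h : ∃ k ∈ x, k ∈ y ∧ v ∉ k) :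
    grom G v x y ≠ 0 := by
  unfold grom
  rw [Set.encard_ne_zero]
  obtain ⟨k, h1, h2, h3⟩ := h
  exact ⟨k, h1, h2, h3⟩

theorem memA_of_FP {x y z w : Set (Set V)} (h1 : FP G x z) (h2 : FP G y w) (h3 : FP G x w)
    (h4 : FP G y z) : memA G x y z w := by
  intro v
  refine Or.inr (Or.inr ⟨?_, ?_⟩)
  · simp only [tripod]
    exact WithTop.add_ne_top.2 ⟨h1.grom v, h2.grom v⟩
  · simp only [tripod]
    exact WithTop.add_ne_top.2 ⟨h3.grom v, h4.grom v⟩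

theorem memA_of_FP' {x y z w : Set (Set V)} (h1 : FP G x y) (h2 : FP G z w) (h3 : FP G x w)
    (h4 : FP G y z) : memA G x y z w := by
  intro v
  refine Or.inr (Or.inl ⟨?_, ?_⟩)
  · simp only [tripod]
    exact WithTop.add_ne_top.2 ⟨h1.grom v, h2.grom v⟩
  · simp only [tripod]
    exact WithTop.add_ne_top.2 ⟨h3.grom v, h4.grom v⟩

theorem not_FP_self (hG : IsCCC G) {x : Set (Set V)} (hx : IsBdryPt G x) : ¬ FP G x x := by
  intro h
  obtain ⟨v⟩ := hG.1.nonempty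
  refine bdry_infinite hG hx v ((h v).subset ?_)
  rintro k ⟨h1, h2⟩
  exact ⟨h1, h1, h2⟩

theorem FP_map (hG' : IsCCC G') {f : Bdry G → Bdry G'} (hmob : Mobius G G' f) {a b : Bdry G}
    (h : FP G a.1 b.1) : FP G' (f a).1 (f b).1 := by
  have hA := (hmob a a b b (memA_of_FP h h h h)).1
  obtain ⟨v⟩ := hG'.1.nonempty
  have hinf : grom G' v (f a).1 (f a).1 = ⊤ := by
    by_contra hn
    exact not_FP_self hG' (f a).2 (FP_of_grom hG' (f a).2.1 hn)
  have := hA v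
  simp only [inA, tripod, hinf, top_add, ne_eq, not_true_eq_false, false_and, false_or] at this
  exact FP_of_grom hG' (f a).2.1 (v := v) (WithTop.add_ne_top.1 this.1).1

theorem good_pair (hG : IsCCC G) (hG' : IsCCC G') {f : Bdry G → Bdry G'} (hmob : Mobius G G' f)
    {a b z w : Bdry G} (haz : FP G a.1 z.1) (haw : FP G a.1 w.1) (hbz : FP G b.1 z.1)
    (hbw : FP G b.1 w.1) (hzw : FP G z.1 w.1) (hab : FP G' (f a).1 (f b).1) :
    FP G a.1 b.1 := by
  obtain ⟨v⟩ := hG.1.nonempty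
  obtain ⟨v'⟩ := hG'.1.nonempty
  have h := (hmob a z b w (memA_of_FP' haz hbw haw hbz.symm)).2 v v'
  by_contra hn
  have hinf : grom G v a.1 b.1 = ⊤ := by
    by_contra hn'
    exact hn (FP_of_grom hG a.2.1 hn')
  unfold crv at h
  rw [hinf, toE_top] at h
  have n1 := toE_ne_top (hab.grom v')
  have n2 := toE_ne_top ((FP_map hG' hmob hzw).grom v')
  have n3 := toE_ne_top (haw.grom v)
  have n4 := toE_ne_top (hbz.symm.grom v)
  have n5 := toE_ne_bot (grom G v z.1 w.1)
  have e1 : (⊤ : EReal) + toE (grom G v z.1 w.1) = ⊤ := EReal.top_add_of_ne_bot n5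
  rw [e1] at h
  have e2 : ∀ t : EReal, t ≠ ⊤ → (⊤ : EReal) - t = ⊤ := by
    intro t ht
    rw [sub_eq_add_neg]
    exact EReal.top_add_of_ne_bot (by simpa using ht)
  rw [e2 _ n3, e2 _ n4] at h
  have e3 : ∀ s t : EReal, s ≠ ⊤ → 0 ≤ t → s - t ≠ ⊤ := by
    intro s t hs ht h'
    have : s - t ≤ s := by
      calc s - t ≤ s - 0 := EReal.sub_le_sub le_rfl ht
        _ = s := by simp
    rw [h'] at this
    exact hs (top_le_iff.1 this)
  exact e3 _ _ (e3 _ _ (EReal.add_ne_top n1 n2) (toE_nonneg _)) (toE_nonneg _) h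

theorem transfer (hG : IsCCC G) (hG' : IsCCC G') (hne' : NoExtremal G')
    {f : Bdry G → Bdry G'} (hsurj : Function.Surjective f) (hmob : Mobius G G' f)
    {a b c : Bdry G} {m : V} (hm : med a.1 b.1 c.1 = princ G m) (hNT : NT a.1 b.1 m)
    (hc : ∀ w : Bdry G, FP G' (f c).1 (f w).1 → FP G c.1 w.1)
    {m' : V'} (hm' : med (f a).1 (f b).1 (f c).1 = princ G' m') :
    NT (f a).1 (f b).1 m' := by
  by_contra hn
  obtain ⟨w', hw', hcw', haw', hbw'⟩ := exists_witness hG' hne' (f a).2.1 (f b).2.1 (f c).2.1 hm' hn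
  obtain ⟨w, hw⟩ := hsurj ⟨w', hw'⟩
  have hww : (f w).1 = w' := by rw [hw]
  rw [← hww] at hcw' haw' hbw'
  have hcw : FP G c.1 w.1 := by
    apply hc
    refine FP_of hG' (f c).2.1 (v := m') ?_
    convert Set.finite_empty
    ext k
    simp only [mem_ofPred_eq, mem_empty_iff_false, iff_false]
    rintro ⟨h1, h2, h3⟩
    exact h3 (hcw' k h1 h2)
  have hab : FP G a.1 b.1 := FP_of_med_princ hG a.2.1 hm
  have hbc : FP G b.1 c.1 := FP_of_med_princ hG b.2.1 (by rw [← med_rot]; exact hm)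
  have hca : FP G c.1 a.1 := FP_of_med_princ hG c.2.1 (by rw [med_rot]; exact hm)
  -- the key computation
  have key : ∀ a b : Bdry G, FP G a.1 b.1 → FP G b.1 c.1 → med a.1 b.1 c.1 = princ G m →
      med (f a).1 (f b).1 (f c).1 = princ G' m' →
      (∃ h ∈ (f a).1, h ∈ (f w).1 ∧ m' ∉ h) → (∀ k ∈ a.1, k ∈ w.1 → m ∈ k) → False := by
    intro a b hab hbc hm hm' haw' haw
    have haw0 : FP G a.1 w.1 := by
      refine FP_of hG a.2.1 (v := m) ?_
      convert Set.finite_empty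
      ext k
      simp only [mem_ofPred_eq, mem_empty_iff_false, iff_false]
      rintro ⟨h1, h2, h3⟩
      exact h3 (haw k h1 h2)
    have h := (hmob a c b w (memA_of_FP hab hcw haw0 hbc.symm)).2 m m'
    unfold crv at h
    rw [grom_zero (G := G) (x := a.1) (y := b.1) (fun k h1 h2 => med_mem hm (Or.inl ⟨h1, h2⟩)),
      grom_zero (G := G) (x := a.1) (y := w.1) haw,
      grom_zero (G := G) (x := c.1) (y := b.1)
        (fun k h1 h2 => med_mem hm (Or.inr (Or.inl ⟨h2, h1⟩))),
      grom_zero (G := G') (x := (f a).1) (y := (f b).1)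
        (fun k h1 h2 => med_mem hm' (Or.inl ⟨h1, h2⟩)),
      grom_zero (G := G') (x := (f c).1) (y := (f w).1) hcw',
      grom_zero (G := G') (x := (f c).1) (y := (f b).1)
        (fun k h1 h2 => med_mem hm' (Or.inr (Or.inl ⟨h2, h1⟩)))] at h
    have hpos := toE_pos (grom_ne_zero (G := G') haw')
    simp only [toE_zero, zero_add, sub_zero, zero_sub] at h
    have h0 := toE_nonneg (grom G m c.1 w.1)
    rw [← h] at h0
    have : toE (grom G' m' (f a).1 (f w).1) ≤ 0 := by
      have := EReal.neg_le_neg_iff.2 h0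
      simpa using this
    exact absurd hpos (not_lt.2 this)
  by_cases h1 : ∀ k ∈ a.1, k ∈ w.1 → m ∈ k
  · exact key a b hab hbc hm hm' haw' h1
  · push Not at h1
    obtain ⟨k, hka, hkw, hmk⟩ := h1
    refine key b a hab.symm hca.symm (by rw [← med_swap]; exact hm)
      (by rw [← med_swap]; exact hm') hbw' ?_
    intro l hlb hlw
    by_contra hml
    exact hNT k hka l hlb hmk hml (w.2.1.2.2 k hkw l hlw)

end mob
end CCCR

namespace CCCR
section bad
variable {V : Type*} {G : SimpleGraph V}

/-- A pair of boundary points with infinite Gromov product, such that there are no two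
points having finite product with both of them and with each other. -/
structure Bad (G : SimpleGraph V) (x y : Set (Set V)) : Prop where
  hx : IsBdryPt G x
  hy : IsBdryPt G y
  inf : ¬ FP G x y
  hB : ∀ z w, IsBdryPt G z → IsBdryPt G w → FP G x z → FP G y z → FP G x w → FP G y w →
    ¬ FP G z w

theorem FP_of_forall (hG : IsCCC G) {x y : Set (Set V)} (hx : IsUltra G x) {v : V}
    (h : ∀ k ∈ x, k ∈ y → v ∈ k) : FP G x y := by
  refine FP_of hG hx (v := v) ?_
  convert Set.finite_empty
  ext k
  simp only [mem_ofPred_eq, mem_empty_iff_false, iff_false]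
  rintro ⟨h1, h2, h3⟩
  exact h3 (h k h1 h2)

theorem Bad.symm {x y : Set (Set V)} (b : Bad G x y) : Bad G y x :=
  ⟨b.hy, b.hx, fun h => b.inf h.symm, fun z w hz hw h1 h2 h3 h4 => b.hB z w hz hw h2 h1 h4 h3⟩

theorem Bad.straight0 (hG : IsCCC G) (hne : NoExtremal G) {x y : Set (Set V)} (b : Bad G x y)
    {h : Set V} (hx : h ∈ x) (hy : h ∈ y) {v u : V} (hvu : G.Adj v u) (hv : v ∈ h) (hu : u ∉ h) :
    ∃ z, IsBdryPt G z ∧ (∀ k ∈ z, v ∉ k → k ⊆ hᶜ) ∧ hᶜ ∈ z ∧ FP G x z ∧ FP G y z := by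
  have hH := b.hx.1.1 h hx
  have he : hᶜ = edgeHalf G v u := half_eq_edge hG (half_compl hG hH) hvu (fun h' => h' hv) hu
  obtain ⟨z, hz, h1, h2⟩ := exists_straight hG hne hvu
  rw [← he] at h1 h2
  refine ⟨z, hz, h2, h1, ?_, ?_⟩
  · refine FP_of_forall hG b.hx.1 (v := v) ?_
    intro k hk hkz
    by_contra hvk
    obtain ⟨p, hp1, hp2⟩ := b.hx.1.2.2 k hk h hx
    exact h2 k hkz hvk hp1 hp2
  · refine FP_of_forall hG b.hy.1 (v := v) ?_
    intro k hk hkz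
    by_contra hvk
    obtain ⟨p, hp1, hp2⟩ := b.hy.1.2.2 k hk h hy
    exact h2 k hkz hvk hp1 hp2

theorem Bad.straightN (hG : IsCCC G) (hne : NoExtremal G) {x y : Set (Set V)} (b : Bad G x y)
    {h : Set V} (hx : h ∈ x) (hy : h ∈ y) {v u : V} (hvu : G.Adj v u) (hv : v ∈ h) (hu : u ∉ h) :
    ∃ z, IsBdryPt G z ∧ (∀ k ∈ z, v ∉ k → k ⊆ hᶜ) ∧ (∀ h2 ∈ x, h2 ∈ y → h2ᶜ ∈ z) := by
  obtain ⟨z, hz, h1, h2, h3, h4⟩ := b.straight0 hG hne hx hy hvu hv hu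
  refine ⟨z, hz, h1, ?_⟩
  intro g hgx hgy
  have hH := b.hx.1.1 g hgx
  obtain ⟨p, q, hpq, hg⟩ := hH
  have hg' : g = edgeHalf G p q := hg
  obtain ⟨z2, hz2, k1, k2, k3, k4⟩ := b.straight0 hG hne hgx hgy hpq.symm
    (by rw [hg']; exact mem_edgeHalf_right hpq) (by rw [hg']; exact not_mem_edgeHalf_left)
  have := inf_of_not_FP hG hz.1 (b.hB z z2 hz hz2 h3 h4 k3 k4) q
  obtain ⟨k, hk1, hk2, hk3⟩ := this.nonempty
  exact u_up hz.1 hk1 (half_compl hG (b.hx.1.1 g hgx)) (k1 k hk2 hk3)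

theorem Bad.exists_edge {x y : Set (Set V)} (b : Bad G x y) {h : Set V} (hx : h ∈ x) :
    ∃ v u, G.Adj v u ∧ v ∈ h ∧ u ∉ h := by
  obtain ⟨p, q, hpq, hg⟩ := b.hx.1.1 h hx
  have hg' : h = edgeHalf G p q := hg
  exact ⟨q, p, hpq.symm, by rw [hg']; exact mem_edgeHalf_right hpq,
    by rw [hg']; exact not_mem_edgeHalf_left⟩

theorem Bad.chain (hG : IsCCC G) (hne : NoExtremal G) {x y : Set (Set V)} (b : Bad G x y)
    {h g : Set V} (hx : h ∈ x) (hy : h ∈ y) (gx : g ∈ x) (gy : g ∈ y) : h ⊆ g ∨ g ⊆ h := by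
  obtain ⟨p, hp1, hp2⟩ := b.hx.1.2.2 h hx g gx
  obtain ⟨v0, u0, e1, e2, e3⟩ := b.exists_edge hx
  obtain ⟨z0, hz0, -, hz1⟩ := b.straightN hG hne hx hy e1 e2 e3
  obtain ⟨q, hq1, hq2⟩ := hz0.1.2.2 _ (hz1 h hx hy) _ (hz1 g gx gy)
  obtain ⟨v, u, hvu, hv, hu, -, -⟩ := exists_cross hG _ (h ∩ g) p q rfl ⟨hp1, hp2⟩
    (fun h' => hq1 h'.1)
  by_cases huh : u ∈ h
  · have hug : u ∉ g := fun h' => hu ⟨huh, h'⟩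
    obtain ⟨z, hz, k1, k2⟩ := b.straightN hG hne gx gy hvu hv.2 hug
    exact Or.inr (compl_subset_compl.1 (k1 _ (k2 h hx hy) (fun h' => h' hv.1)))
  · obtain ⟨z, hz, k1, k2⟩ := b.straightN hG hne hx hy hvu hv.1 huh
    exact Or.inl (compl_subset_compl.1 (k1 _ (k2 g gx gy) (fun h' => h' hv.2)))

theorem Bad.T_aux (hG : IsCCC G) (hne : NoExtremal G) {x y : Set (Set V)} (b : Bad G x y)
    {h g : Set V} (hx : h ∈ x) (hy : h ∈ y) (gx : g ∈ x) (gy : g ∉ y) : (hᶜ ∩ g).Nonempty := by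
  by_contra hn
  have hgh : g ⊆ h := by
    intro p hp
    by_contra hp'
    exact hn ⟨p, hp', hp⟩
  have hgH := b.hx.1.1 g gx
  obtain ⟨p, hp, -⟩ := b.hx.1.2.2 g gx g gx
  obtain ⟨h', hh'x, hh'y, hph'⟩ := (inf_of_not_FP hG b.hx.1 b.inf p).nonempty
  obtain ⟨q, hq1, hq2⟩ := b.hx.1.2.2 h' hh'x g gx
  obtain ⟨v, u, hvu, hv, hu, hvI, huI⟩ := exists_cross hG _ h' q p rfl hq1 hph'
  have hvg : v ∈ g := half_convex hG hgH hq2 hp hvI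
  obtain ⟨z, hz, k1, k2⟩ := b.straightN hG hne hh'x hh'y hvu hv hu
  have hgz : gᶜ ∈ z := u_up hz.1 (k2 h hx hy) (half_compl hG hgH) (compl_subset_compl.2 hgh)
  have hs := k1 _ hgz (fun h => h hvg)
  obtain ⟨r, hr1, hr2⟩ := b.hy.1.2.2 _ (u_not b.hy.1 hgH gy) _ hh'y
  exact hs hr1 hr2

/-- The wall of `h` does not separate `x` from `y`. -/
def On (x y : Set (Set V)) (h : Set V) : Prop := (h ∈ x ∧ h ∈ y) ∨ (hᶜ ∈ x ∧ hᶜ ∈ y)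

theorem On_compl {x y : Set (Set V)} {h : Set V} : On x y hᶜ ↔ On x y h := by
  unfold On; rw [compl_compl]; tauto

theorem Bad.T (hG : IsCCC G) (hne : NoExtremal G) {x y : Set (Set V)} (b : Bad G x y)
    {h g : Set V} (hh : On x y h) (hgH : IsHalfspace G g) (hg : ¬ On x y g) :
    (h ∩ g).Nonempty := by
  have key : ∀ x y : Set (Set V), Bad G x y → ∀ h g, IsHalfspace G g → h ∈ x → h ∈ y → g ∈ x →
      g ∉ y → (h ∩ g).Nonempty ∧ (hᶜ ∩ g).Nonempty ∧ (h ∩ gᶜ).Nonempty ∧ (hᶜ ∩ gᶜ).Nonempty := by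
    intro x y b h g hgH hx hy gx gy
    refine ⟨b.hx.1.2.2 _ hx _ gx, b.T_aux hG hne hx hy gx gy,
      b.hy.1.2.2 _ hy _ (u_not b.hy.1 hgH gy),
      b.symm.T_aux hG hne hy hx (u_not b.hy.1 hgH gy) (u_compl b.hx.1 gx)⟩
  have key2 : ∀ h, h ∈ x → h ∈ y → (h ∩ g).Nonempty ∧ (hᶜ ∩ g).Nonempty := by
    intro h hx hy
    by_cases gx : g ∈ x
    · have := key x y b h g hgH hx hy gx (fun h' => hg (Or.inl ⟨gx, h'⟩))
      exact ⟨this.1, this.2.1⟩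
    · by_cases gy : g ∈ y
      · have := key y x b.symm h g hgH hy hx gy gx
        exact ⟨this.1, this.2.1⟩
      · exact absurd (Or.inr ⟨u_not b.hx.1 hgH gx, u_not b.hy.1 hgH gy⟩) hg
  rcases hh with hh | hh
  · exact (key2 h hh.1 hh.2).1
  · have := (key2 _ hh.1 hh.2).2
    rwa [compl_compl] at this

/-- Mixture of two ultrafilters. -/
def mix (x y σ τ : Set (Set V)) : Set (Set V) :=
  {h | (h ∈ σ ∧ On x y h) ∨ (h ∈ τ ∧ ¬ On x y h)}

theorem Bad.mix_ultra (hG : IsCCC G) (hne : NoExtremal G) {x y : Set (Set V)} (b : Bad G x y)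
    {σ τ : Set (Set V)} (hσ : IsUltra G σ) (hτ : IsUltra G τ) : IsUltra G (mix x y σ τ) := by
  refine ⟨?_, ?_, ?_⟩
  · rintro h (hh | hh)
    · exact hσ.1 h hh.1
    · exact hτ.1 h hh.1
  · intro h hh
    have h1 := hσ.2.1 h hh
    have h2 := hτ.2.1 h hh
    have h3 := On_compl (x := x) (y := y) (h := h)
    simp only [mix, mem_ofPred_eq]
    tauto
  · rintro h (hh | hh) k (hk | hk)
    · exact hσ.2.2 h hh.1 k hk.1
    · exact b.T hG hne hh.2 (hτ.1 k hk.1) hk.2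
    · rw [inter_comm]
      exact b.T hG hne hk.2 (hτ.1 h hh.1) hh.2
    · exact hτ.2.2 h hh.1 k hk.1

/-- Infinitely many walls in the negative direction. -/
theorem Bad.neg (hG : IsCCC G) (hne : NoExtremal G) {x y : Set (Set V)} (b : Bad G x y) :
    ∃ z, IsBdryPt G z ∧ (∀ h2 ∈ x, h2 ∈ y → h2ᶜ ∈ z) ∧
      ∀ v, {k | (k ∈ z ∧ On x y k) ∧ v ∉ k}.Infinite := by
  obtain ⟨v0⟩ := hG.1.nonempty
  obtain ⟨h, hx, hy, -⟩ := (inf_of_not_FP hG b.hx.1 b.inf v0).nonempty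
  obtain ⟨v1, u, e1, e2, e3⟩ := b.exists_edge hx
  obtain ⟨z, hz, k1, k2⟩ := b.straightN hG hne hx hy e1 e2 e3
  refine ⟨z, hz, k2, ?_⟩
  intro v hf
  apply bdry_infinite hG hz v1
  refine (hf.union (finite_sep' hG v v1)).subset ?_
  rintro k ⟨hk1, hk2⟩
  have hkH := hz.1.1 k hk1
  have hs := k1 k hk1 hk2
  by_cases hv : v ∈ k
  · exact Or.inr ⟨hkH, hv, hk2⟩
  · refine Or.inl ⟨⟨hk1, Or.inr ⟨?_, ?_⟩⟩, hv⟩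
    · exact u_up b.hx.1 hx (half_compl hG hkH) (subset_compl_comm.1 hs)
    · exact u_up b.hy.1 hy (half_compl hG hkH) (subset_compl_comm.1 hs)

theorem Bad.off_inf (hG : IsCCC G) (hne : NoExtremal G) {x y : Set (Set V)} (b : Bad G x y)
    (hxy : x ≠ y) (v : V) : {k | (k ∈ y ∧ ¬ On x y k) ∧ v ∉ k}.Infinite := by
  -- a halfspace in x but not in y
  obtain ⟨g, gx, gy⟩ : ∃ g, g ∈ x ∧ g ∉ y := by
    by_contra hn
    push Not at hn
    apply hxy
    apply Subset.antisymm hn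
    intro k hk
    by_contra hk'
    exact u_compl b.hy.1 hk (hn _ (u_not b.hx.1 (b.hy.1.1 k hk) hk'))
  have hgH := b.hx.1.1 g gx
  have hgoff : ¬ On x y g := by
    rintro (h | h)
    · exact gy h.2
    · exact u_compl b.hx.1 gx h.1
  obtain ⟨v1, u, e1, e2, e3⟩ := b.exists_edge gx
  have he : gᶜ = edgeHalf G v1 u := half_eq_edge hG (half_compl hG hgH) e1 (fun h' => h' e2) e3
  obtain ⟨w, hw, h1, h2⟩ := exists_straight hG hne e1
  rw [← he] at h1 h2
  intro hf
  apply bdry_infinite hG hw v1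
  refine (hf.union (finite_sep' hG v v1)).subset ?_
  rintro k ⟨hk1, hk2⟩
  have hkH := hw.1.1 k hk1
  have hs := h2 k hk1 hk2
  by_cases hv : v ∈ k
  · exact Or.inr ⟨hkH, hv, hk2⟩
  · have hkoff : ¬ On x y k := by
      intro hk
      obtain ⟨p, hp1, hp2⟩ := b.T hG hne hk hgH hgoff
      exact hs hp1 hp2
    have hkx : k ∉ x := by
      intro hk
      obtain ⟨p, hp1, hp2⟩ := b.hx.1.2.2 k hk g gx
      exact hs hp1 hp2
    refine Or.inl ⟨⟨?_, hkoff⟩, hv⟩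
    by_contra hky
    exact hkoff (Or.inr ⟨u_not b.hx.1 hkH hkx, u_not b.hy.1 hkH hky⟩)

end bad
end CCCR

namespace CCCR
section bad2
variable {V V' : Type*} {G : SimpleGraph V} {G' : SimpleGraph V'}

theorem On_symm {x y : Set (Set V)} {h : Set V} : On x y h ↔ On y x h := by
  unfold On; tauto

theorem Bad.mix_not_bad (hG : IsCCC G) (hne : NoExtremal G) {x y : Set (Set V)} (b : Bad G x y)
    (u : V) {w : Set (Set V)} : ¬ Bad G (mix x y (princ G u) y) w := by
  intro b2
  obtain ⟨g, hg1, hg2, hg3⟩ := (inf_of_not_FP hG b2.hx.1 b2.inf u).nonempty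
  have hgH := b2.hx.1.1 g hg1
  have hgoff : ¬ On x y g := by
    rcases hg1 with h | h
    · exact absurd h.1.2 hg3
    · exact h.2
  have hno : ∀ h, On x y h → h ∈ mix x y (princ G u) y → h ∉ w := by
    intro h hon h1 h2
    rcases b2.chain hG hne h1 h2 hg1 hg2 with hc | hc
    · obtain ⟨p, hp1, hp2⟩ := b.T hG hne hon (half_compl hG hgH) (fun h' => hgoff (On_compl.1 h'))
      exact hp2 (hc hp1)
    · obtain ⟨p, hp1, hp2⟩ := b.T hG hne (On_compl.2 hon) hgH hgoff
      exact hp1 (hc hp2)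
  obtain ⟨z, hz, hz1, hz2⟩ := b.neg hG hne
  obtain ⟨k, ⟨hkz, hkon⟩, huk⟩ := (hz2 u).nonempty
  have hkH := hz.1.1 k hkz
  have hkC : kᶜ ∈ x ∧ kᶜ ∈ y := by
    rcases hkon with h | h
    · exact absurd (hz1 k h.1 h.2) (u_compl hz.1 hkz)
    · exact h
  obtain ⟨l, hlx, hly, hul⟩ := (inf_of_not_FP hG b.hx.1 b.inf u).nonempty
  have hlH := b.hx.1.1 l hlx
  have hlon : On x y l := Or.inl ⟨hlx, hly⟩
  have hkw : k ∈ w := by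
    by_contra hn
    exact hno _ (On_compl.2 hkon) (Or.inl ⟨⟨half_compl hG hkH, huk⟩, On_compl.2 hkon⟩)
      (u_not b2.hy.1 hkH hn)
  have hlw : l ∈ w := by
    by_contra hn
    exact hno _ (On_compl.2 hlon) (Or.inl ⟨⟨half_compl hG hlH, hul⟩, On_compl.2 hlon⟩)
      (u_not b2.hy.1 hlH hn)
  obtain ⟨p, hp1, hp2⟩ := b2.hy.1.2.2 k hkw l hlw
  rcases b.chain hG hne hkC.1 hkC.2 hlx hly with hc | hc
  · exact hul (hc huk)
  · exact hc hp2 hp1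

theorem bad_of (hG : IsCCC G) (hG' : IsCCC G') {f : Bdry G → Bdry G'} (hmob : Mobius G G' f)
    {a b : Bdry G} (h : ¬ FP G a.1 b.1) (h' : FP G' (f a).1 (f b).1) : Bad G a.1 b.1 := by
  refine ⟨a.2, b.2, h, ?_⟩
  intro z w hz hw h1 h2 h3 h4 h5
  exact h (good_pair hG hG' hmob (a := a) (b := b) (z := ⟨z, hz⟩) (w := ⟨w, hw⟩) h1 h3 h2 h4 h5 h')

theorem Bad.far (hG : IsCCC G) (hne : NoExtremal G) {x y : Set (Set V)} (b : Bad G x y)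
    (v : V) (d : ℕ) : ∃ u, ((d + 1 : ℕ) : ℕ∞) ≤ {k | (k ∈ x ∧ k ∈ y ∧ v ∉ k) ∧ u ∈ k}.encard ∧
      ∀ k ∈ x, k ∈ y → v ∈ k → u ∈ k := by
  obtain ⟨S, hS, hcard⟩ := (inf_of_not_FP hG b.hx.1 b.inf v).exists_subset_card_eq (d + 1)
  have hSne : S.Nonempty := by
    rw [← Finset.card_pos]; omega
  obtain ⟨k0, hk0S, hmin⟩ := S.exists_minimal hSne
  have hk0 := hS hk0S
  obtain ⟨u, hu, -⟩ := b.hx.1.2.2 k0 hk0.1 k0 hk0.1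
  refine ⟨u, ?_, ?_⟩
  · rw [← hcard, ← Set.encard_coe_eq_coe_finsetCard]
    apply Set.encard_le_encard
    intro k hk
    have hk' := hS hk
    refine ⟨hk', ?_⟩
    rcases b.chain hG hne hk'.1 hk'.2.1 hk0.1 hk0.2.1 with hc | hc
    · exact hmin hk hc hu
    · exact hc hu
  · intro k hkx hky hvk
    rcases b.chain hG hne hkx hky hk0.1 hk0.2.1 with hc | hc
    · exact absurd (hc hvk) hk0.2.2
    · exact hc hu

theorem bad_false (hG : IsCCC G) (hG' : IsCCC G') (hne : NoExtremal G) (hne' : NoExtremal G')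
    {f : Bdry G → Bdry G'} (hsurj : Function.Surjective f) (hmob : Mobius G G' f)
    {x y : Bdry G} (h : ¬ FP G x.1 y.1) (h' : FP G' (f x).1 (f y).1) : False := by
  have b := bad_of hG hG' hmob h h'
  have hxy : x.1 ≠ y.1 := by
    intro he
    have : x = y := Subtype.ext he
    subst this
    exact not_FP_self hG' (f x).2 h'
  obtain ⟨v⟩ := hG.1.nonempty
  obtain ⟨z0, hz0, hz1, hz2⟩ := b.neg hG hne
  have hxC : ∀ k ∈ x.1, On x.1 y.1 k → k ∈ y.1 := by
    rintro k hk (h | h)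
    · exact h.2
    · exact absurd h.1 (u_compl x.2.1 hk)
  have hzC : ∀ k ∈ z0, On x.1 y.1 k → kᶜ ∈ x.1 ∧ kᶜ ∈ y.1 := by
    rintro k hk (h | h)
    · exact absurd (hz1 k h.1 h.2) (u_compl hz0.1 hk)
    · exact h
  have hinf := inf_of_not_FP hG x.2.1 h v
  -- the auxiliary points
  obtain ⟨z, hzdef⟩ : ∃ z : Bdry G, z.1 = mix x.1 y.1 z0 (princ G v) := by
    refine ⟨⟨_, bdry_of_infinite hG (b.mix_ultra hG hne hz0.1 (princ_ultra hG v)) (v := v) ?_⟩, rfl⟩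
    refine (hz2 v).mono ?_
    rintro k ⟨h1, h2⟩
    exact ⟨Or.inl h1, h2⟩
  obtain ⟨n, hndef⟩ : ∃ n : Bdry G, n.1 = mix x.1 y.1 x.1 (princ G v) := by
    refine ⟨⟨_, bdry_of_infinite hG (b.mix_ultra hG hne x.2.1 (princ_ultra hG v)) (v := v) ?_⟩, rfl⟩
    refine hinf.mono ?_
    rintro k ⟨h1, h2, h3⟩
    exact ⟨Or.inl ⟨h1, Or.inl ⟨h1, h2⟩⟩, h3⟩
  have hr : ∀ u, ∃ r : Bdry G, r.1 = mix x.1 y.1 (princ G u) y.1 := by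
    intro u
    refine ⟨⟨_, bdry_of_infinite hG (b.mix_ultra hG hne (princ_ultra hG u) y.2.1) (v := v) ?_⟩, rfl⟩
    refine (b.off_inf hG hne hxy v).mono ?_
    rintro k ⟨h1, h2⟩
    exact ⟨Or.inr h1, h2⟩
  choose r hrdef using hr
  obtain ⟨s, hsdef⟩ : ∃ s : Bdry G, s.1 = mix x.1 y.1 (princ G v) x.1 := by
    refine ⟨⟨_, bdry_of_infinite hG (b.mix_ultra hG hne (princ_ultra hG v) x.2.1) (v := v) ?_⟩, rfl⟩
    refine (b.symm.off_inf hG hne hxy.symm v).mono ?_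
    rintro k ⟨⟨h1, h3⟩, h2⟩
    exact ⟨Or.inr ⟨h1, fun h => h3 (On_symm.1 h)⟩, h2⟩
  have mz : ∀ k ∈ z.1, (kᶜ ∈ x.1 ∧ kᶜ ∈ y.1 ∧ On x.1 y.1 k) ∨ (v ∈ k ∧ ¬ On x.1 y.1 k) := by
    intro k hk
    rw [hzdef] at hk
    rcases hk with hk | hk
    · have := hzC k hk.1 hk.2
      exact Or.inl ⟨this.1, this.2, hk.2⟩
    · exact Or.inr ⟨hk.1.2, hk.2⟩
  have mn : ∀ k ∈ n.1, (k ∈ x.1 ∧ k ∈ y.1 ∧ On x.1 y.1 k) ∨ (v ∈ k ∧ ¬ On x.1 y.1 k) := by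
    intro k hk
    rw [hndef] at hk
    rcases hk with hk | hk
    · exact Or.inl ⟨hk.1, hxC k hk.1 hk.2, hk.2⟩
    · exact Or.inr ⟨hk.1.2, hk.2⟩
  have mr : ∀ u, ∀ k ∈ (r u).1, (u ∈ k ∧ On x.1 y.1 k) ∨ (k ∈ y.1 ∧ ¬ On x.1 y.1 k) := by
    intro u k hk
    rw [hrdef] at hk
    rcases hk with hk | hk
    · exact Or.inl ⟨hk.1.2, hk.2⟩
    · exact Or.inr hk
  have ms : ∀ k ∈ s.1, (v ∈ k ∧ On x.1 y.1 k) ∨ (k ∈ x.1 ∧ ¬ On x.1 y.1 k) := by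
    intro k hk
    rw [hsdef] at hk
    rcases hk with hk | hk
    · exact Or.inl ⟨hk.1.2, hk.2⟩
    · exact Or.inr hk
  have xc : ∀ k, k ∈ x.1 → kᶜ ∉ x.1 := fun k hk => u_compl x.2.1 hk
  have yc : ∀ k, k ∈ y.1 → kᶜ ∉ y.1 := fun k hk => u_compl y.2.1 hk
  have hon : ∀ k, k ∈ x.1 → k ∈ y.1 → On x.1 y.1 k := fun k h1 h2 => Or.inl ⟨h1, h2⟩
  have zn : FP G z.1 n.1 := FP_of_forall hG z.2.1 (v := v) (by
    intro k h1 h2; have := mz k h1; have := mn k h2; have := xc k; tauto)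
  have zx : FP G z.1 x.1 := FP_of_forall hG z.2.1 (v := v) (by
    intro k h1 h2; have := mz k h1; have := xc k; tauto)
  have zy : FP G z.1 y.1 := FP_of_forall hG z.2.1 (v := v) (by
    intro k h1 h2; have := mz k h1; have := yc k; tauto)
  have sy : FP G s.1 y.1 := FP_of_forall hG s.2.1 (v := v) (by
    intro k h1 h2; have := ms k h1; have := hon k; tauto)
  have sz : FP G s.1 z.1 := FP_of_forall hG s.2.1 (v := v) (by
    intro k h1 h2; have := ms k h1; have := mz k h2; tauto)
  have sn : FP G s.1 n.1 := FP_of_forall hG s.2.1 (v := v) (by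
    intro k h1 h2; have := ms k h1; have := mn k h2; tauto)
  have rx : ∀ u, FP G (r u).1 x.1 := fun u => FP_of_forall hG (r u).2.1 (v := u) (by
    intro k h1 h2; have := mr u k h1; have := hon k; tauto)
  have zr : ∀ u, FP G z.1 (r u).1 := fun u => FP_of hG z.2.1 (v := v) (by
    refine (finite_sep' hG u v).subset ?_
    rintro k ⟨h1, h2, h3⟩
    refine ⟨z.2.1.1 k h1, ?_, h3⟩
    have := mz k h1; have := mr u k h2; tauto)
  have nr : ∀ u, FP G n.1 (r u).1 := fun u => FP_of hG n.2.1 (v := v) (by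
    refine (finite_sep' hG u v).subset ?_
    rintro k ⟨h1, h2, h3⟩
    refine ⟨n.2.1.1 k h1, ?_, h3⟩
    have := mn k h1; have := mr u k h2; tauto)
  have Cn : ∀ k, k ∈ x.1 → k ∈ y.1 → k ∈ n.1 := by
    intro k h1 h2
    rw [hndef]
    exact Or.inl ⟨h1, hon k h1 h2⟩
  have nnx : ¬ FP G' (f n).1 (f x).1 := by
    intro hf
    have := good_pair hG hG' hmob (a := n) (b := x) (z := z) (w := r v) zn.symm (nr v) zx.symm
      (rx v).symm (zr v) hf
    refine hinf ((this v).subset ?_)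
    rintro k ⟨h1, h2, h3⟩
    exact ⟨Cn k h1 h2, h1, h3⟩
  have nny : ¬ FP G' (f n).1 (f y).1 := by
    intro hf
    have := good_pair hG hG' hmob (a := n) (b := y) (z := z) (w := s) zn.symm sn.symm zy.symm
      sy.symm sz.symm hf
    refine hinf ((this v).subset ?_)
    rintro k ⟨h1, h2, h3⟩
    exact ⟨Cn k h1 h2, h2, h3⟩
  have rgood : ∀ u, ∀ w : Bdry G, FP G' (f (r u)).1 (f w).1 → FP G (r u).1 w.1 := by
    intro u w hf
    by_contra hn
    have b2 := bad_of hG hG' hmob hn hf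
    rw [hrdef] at b2
    exact b.mix_not_bad hG hne u b2
  have zn' := FP_map hG' hmob zn
  have zr' := fun u => FP_map hG' hmob (zr u)
  have nr' := fun u => FP_map hG' hmob (nr u)
  have cut : ∀ u, ∀ h g, h ∈ (f n).1 → g ∈ (f n).1 → h ∉ (f z).1 → g ∉ (f z).1 →
      h ∈ (f (r u)).1 → g ∉ (f (r u)).1 → g ⊆ h := by
    intro u h g hn gn hz gz hr gr
    obtain ⟨m, hm⟩ := med_princ hG z.2.1 n.2.1 (r u).2.1 zn (nr u) (zr u).symm
    obtain ⟨m', hm'⟩ := med_princ hG' (f z).2.1 (f n).2.1 (f (r u)).2.1 zn' (nr' u) (zr' u).symm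
    have hNT : NT z.1 n.1 m := by
      rintro k hk l hl hmk hml ⟨p, hp1, hp2⟩
      have hkn : k ∉ n.1 := fun h' => hmk (med_mem hm (Or.inl ⟨hk, h'⟩))
      have hlz : l ∉ z.1 := fun h' => hml (med_mem hm (Or.inl ⟨h', hl⟩))
      have hkC : kᶜ ∈ x.1 ∧ kᶜ ∈ y.1 := by
        rcases mz k hk with h | h
        · exact ⟨h.1, h.2.1⟩
        · refine absurd ?_ hkn
          rw [hndef]
          exact Or.inr ⟨⟨z.2.1.1 k hk, h.1⟩, h.2⟩
      have hlC : l ∈ x.1 ∧ l ∈ y.1 := by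
        rcases mn l hl with h | h
        · exact ⟨h.1, h.2.1⟩
        · refine absurd ?_ hlz
          rw [hzdef]
          exact Or.inr ⟨⟨n.2.1.1 l hl, h.1⟩, h.2⟩
      rcases b.chain hG hne hkC.1 hkC.2 hlC.1 hlC.2 with hc | hc
      · exact hml (hc hmk)
      · exact hc hp2 hp1
    have hNT' := transfer hG hG' hne' hsurj hmob hm hNT (rgood u) hm'
    have hH := (f n).2.1.1 h hn
    have gH := (f n).2.1.1 g gn
    have hm1 : m' ∈ h := med_mem hm' (Or.inr (Or.inl ⟨hn, hr⟩))
    have hm2 : m' ∈ gᶜ := med_mem hm' (Or.inr (Or.inr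
      ⟨u_not (f (r u)).2.1 gH gr, u_not (f z).2.1 gH gz⟩))
    intro p hp
    by_contra hph
    exact hNT' _ (u_not (f z).2.1 hH hz) g gn (fun h' => h' hm1) hm2 ⟨p, hph, hp⟩
  obtain ⟨m', hm'⟩ := med_princ hG' (f z).2.1 (f n).2.1 (f (r v)).2.1 zn' (nr' v) (zr' v).symm
  have nz : ∀ h ∈ (f n).1, m' ∉ h → h ∉ (f z).1 :=
    fun h h1 h2 h3 => h2 (med_mem hm' (Or.inl ⟨h3, h1⟩))
  have star : ∀ h ∈ (f n).1, m' ∉ h → ∃ u, h ∈ (f (r u)).1 := by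
    intro h hn hmh
    obtain ⟨p, hp, -⟩ := (f n).2.1.2.2 h hn h hn
    have hfin := finite_sep' hG' p m'
    obtain ⟨u, hu1, hu2⟩ := b.far hG hne v hfin.toFinset.card
    refine ⟨u, ?_⟩
    by_contra hru
    have hcr := (hmob z n (r v) (r u) (memA_of_FP (zr v) (nr u) (zr u) (nr v))).2 v m'
    unfold crv at hcr
    rw [grom_zero (G := G) (x := z.1) (y := (r v).1) (v := v) (by
        intro k h1 h2; have := mz k h1; have := mr v k h2; tauto),
      grom_zero (G := G) (x := n.1) (y := (r v).1) (v := v) (by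
        intro k h1 h2; have := mn k h1; have := mr v k h2; tauto),
      grom_zero (G := G) (x := z.1) (y := (r u).1) (v := v) (by
        intro k h1 h2
        rcases mz k h1 with h3 | h3
        · by_contra hvk
          have h4 := hu2 _ h3.1 h3.2.1 hvk
          have := mr u k h2
          have h5 : u ∈ k := by tauto
          exact h4 h5
        · exact h3.1),
      grom_zero (G := G') (x := (f z).1) (y := (f (r v)).1)
        (fun k h1 h2 => med_mem hm' (Or.inr (Or.inr ⟨h2, h1⟩))),
      grom_zero (G := G') (x := (f n).1) (y := (f (r v)).1)
        (fun k h1 h2 => med_mem hm' (Or.inr (Or.inl ⟨h1, h2⟩)))] at hcr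
    simp only [toE_zero, zero_add, sub_zero] at hcr
    have hle : grom G v n.1 (r u).1 ≤ grom G' m' (f n).1 (f (r u)).1 := by
      rw [← toE_le, ← hcr]
      calc _ ≤ toE (grom G' m' (f n).1 (f (r u)).1) - 0 := EReal.sub_le_sub le_rfl (toE_nonneg _)
        _ = _ := by simp
    have hge : ((hfin.toFinset.card + 1 : ℕ) : ℕ∞) ≤ grom G v n.1 (r u).1 := by
      refine hu1.trans (Set.encard_le_encard ?_)
      rintro k ⟨⟨h1, h2, h3⟩, h4⟩
      refine ⟨Cn k h1 h2, ?_, h3⟩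
      rw [hrdef]
      exact Or.inl ⟨⟨x.2.1.1 k h1, h4⟩, hon k h1 h2⟩
    obtain ⟨g, gn, gr, gm, gp⟩ : ∃ g, g ∈ (f n).1 ∧ g ∈ (f (r u)).1 ∧ m' ∉ g ∧ p ∉ g := by
      by_contra hcon
      push Not at hcon
      have h1 : grom G' m' (f n).1 (f (r u)).1 ≤ ((hfin.toFinset.card : ℕ) : ℕ∞) := by
        rw [← Set.encard_coe_eq_coe_finsetCard, Set.Finite.coe_toFinset]
        apply Set.encard_le_encard
        rintro k ⟨h1, h2, h3⟩
        exact ⟨(f n).2.1.1 k h1, hcon k h1 h2 h3, h3⟩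
      have h2 := (hge.trans hle).trans h1
      have h3 : hfin.toFinset.card + 1 ≤ hfin.toFinset.card := by exact_mod_cast h2
      omega
    exact gp (cut u g h gn hn (nz g gn gm) (nz h hn hmh) gr hru hp)
  obtain ⟨k, ⟨hkn, hkx, hkm⟩, hk2⟩ :=
    ((inf_of_not_FP hG' (f n).2.1 nnx m').sdiff (h' m')).nonempty
  have hky : k ∉ (f y).1 := fun hc => hk2 ⟨hkx, hc, hkm⟩
  obtain ⟨u, hku⟩ := star k hkn hkm
  obtain ⟨g, ⟨hgn, hgy, hgm⟩, hg2⟩ :=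
    ((inf_of_not_FP hG' (f n).2.1 nny m').sdiff (nr' u m')).nonempty
  have hgr : g ∉ (f (r u)).1 := fun hc => hg2 ⟨hgn, hc, hgm⟩
  exact hky (u_up (f y).2.1 hgy ((f n).2.1.1 k hkn)
    (cut u k g hkn hgn (nz k hkn hkm) (nz g hgn hgm) hku hgr))

theorem op_forward (hG : IsCCC G) (hG' : IsCCC G') (hne' : NoExtremal G')
    {f : Bdry G → Bdry G'} (hsurj : Function.Surjective f) (hmob : Mobius G G' f)
    (hgood : ∀ a b : Bdry G, FP G' (f a).1 (f b).1 → FP G a.1 b.1) {a b c : Bdry G}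
    (h : Op G a.1 b.1 c.1) : Op G' (f a).1 (f b).1 (f c).1 := by
  rw [op_iff hG a.2.1 b.2.1] at h
  rw [op_iff hG' (f a).2.1 (f b).2.1]
  obtain ⟨m, hm, hNT⟩ := h
  have hab : FP G a.1 b.1 := FP_of_med_princ hG a.2.1 hm
  have hbc : FP G b.1 c.1 := FP_of_med_princ hG b.2.1 (by rw [← med_rot]; exact hm)
  have hca : FP G c.1 a.1 := FP_of_med_princ hG c.2.1 (by rw [med_rot]; exact hm)
  obtain ⟨m', hm'⟩ := med_princ hG' (f a).2.1 (f b).2.1 (f c).2.1 (FP_map hG' hmob hab)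
    (FP_map hG' hmob hbc) (FP_map hG' hmob hca)
  exact ⟨m', hm', transfer hG hG' hne' hsurj hmob hm hNT (hgood c) hm'⟩

end bad2
end CCCR


/-- Proposition `invariance of op`: a Möbius bijection between
Roller boundaries preserves the relation of being opposite. -/
theorem stmt7 {V V' : Type*} (G : SimpleGraph V) (G' : SimpleGraph V')
    (hG : IsCCC G) (hG' : IsCCC G') (hne : NoExtremal G) (hne' : NoExtremal G')
    (f : Bdry G → Bdry G') (hbij : Function.Bijective f) (hmob : Mobius G G' f)
    (x y z : Bdry G) :
    Op G x.1 y.1 z.1 ↔ Op G' (f x).1 (f y).1 (f z).1 := by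
  have hgood : ∀ a b : Bdry G, FP G' (f a).1 (f b).1 → FP G a.1 b.1 := by
    intro a b h
    by_contra hn
    exact bad_false hG hG' hne hne' hbij.2 hmob hn h
  refine ⟨op_forward hG hG' hne' hbij.2 hmob hgood, ?_⟩
  intro h
  let e := Equiv.ofBijective f hbij
  have he : ∀ a, f (e.symm a) = a := fun a => e.apply_symm_apply a
  have he' : ∀ a, e.symm (f a) = a := fun a => e.symm_apply_apply a
  have hmob' : Mobius G' G e.symm := by
    intro a b c d hA
    obtain ⟨a, rfl⟩ := hbij.2 a
    obtain ⟨b, rfl⟩ := hbij.2 b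
    obtain ⟨c, rfl⟩ := hbij.2 c
    obtain ⟨d, rfl⟩ := hbij.2 d
    simp only [he']
    have hA' : memA G a.1 b.1 c.1 d.1 := by
      intro v
      obtain ⟨v'⟩ := hG'.1.nonempty
      have key : ∀ p q r s : Bdry G,
          grom G' v' (f p).1 (f q).1 + grom G' v' (f r).1 (f s).1 ≠ ⊤ →
          grom G v p.1 q.1 + grom G v r.1 s.1 ≠ ⊤ := by
        intro p q r s hs
        obtain ⟨h1, h2⟩ := WithTop.add_ne_top.1 hs
        exact WithTop.add_ne_top.2
          ⟨(hgood _ _ (FP_of_grom hG' (f p).2.1 h1)).grom v,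
            (hgood _ _ (FP_of_grom hG' (f r).2.1 h2)).grom v⟩
      rcases hA v' with h | h | h
      · exact Or.inl ⟨key _ _ _ _ h.1, key _ _ _ _ h.2⟩
      · exact Or.inr (Or.inl ⟨key _ _ _ _ h.1, key _ _ _ _ h.2⟩)
      · exact Or.inr (Or.inr ⟨key _ _ _ _ h.1, key _ _ _ _ h.2⟩)
    exact ⟨hA', fun v v' => ((hmob a b c d hA').2 v' v).symm⟩
  have := op_forward hG' hG hne e.symm.surjective hmob' (fun a b hab => by
    have := FP_map hG' hmob hab
    rwa [he, he] at this) h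
  simpa only [he'] using this
end
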